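/- arXiv:2110.07015 — 3 statements merged into one kernel-verified Lean document; each statement's English description precedes it below -/
import Mathlib

section
/- Suppose that zer A ≠ ∅; that for every k ∈ ℕ, ξ_k ≤ 1, γ_k(β_k + γ_k) ≥ 0, γ_k(2β_k + γ_k) ≥ 0, and |β_k + γ_k|·|γ_k| ≤ max{1 − |β_k|, 2 − 2|β_k + γ_k/2|}; that ∑_k |α_k| < ∞, ∑_k |1 − β_k − γ_k| < ∞, ∑_k γ_k(2β_k + γ_k) = ∞, and ∑_k ‖δ_k e_k‖ < ∞; and that inf_{k∈ℕ} c_k > 0 and ∑_k |c_{k+1} − c_k| < ∞. Then x_k − J_{c_k}(x_k) → 0 strongly, Ω is nonempty, and Ω ⊆ zer A. -/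
open Filter InnerProductSpace

/-- `z` is a weak sequential cluster point of the sequence `y`: some subsequence of `y`
converges weakly to `z`. -/
def WSeqClusterPt {H : Type*} [NormedAddCommGroup H] [InnerProductSpace ℝ H]
    (y : ℕ → H) (z : H) : Prop :=
  ∃ φ : ℕ → ℕ, StrictMono φ ∧
    ∀ w : H, Tendsto (fun k => ⟪y (φ k), w⟫_ℝ) atTop (nhds ⟪z, w⟫_ℝ)


theorem exists_weak_cluster {H : Type*} [NormedAddCommGroup H] [InnerProductSpace ℝ H]
    [CompleteSpace H] (x : ℕ → H) (M : ℝ) (hM : ∀ k, ‖x k‖ ≤ M) :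
    ∃ z : H, WSeqClusterPt x z := by
  let K : Submodule ℝ H := (Submodule.span ℝ (Set.range x)).topologicalClosure
  have hxK : ∀ k, x k ∈ K := fun k =>
    Submodule.le_topologicalClosure _ (Submodule.subset_span ⟨k, rfl⟩)
  have hcl : IsClosed (K : Set H) := Submodule.isClosed_topologicalClosure _
  have : CompleteSpace K := hcl.completeSpace_coe
  have hsep : TopologicalSpace.IsSeparable (K : Set H) := by
    have h1 : TopologicalSpace.IsSeparable (Set.range x) := (Set.countable_range x).isSeparable
    have h2 := (h1.span (R := ℝ)).closure
    simpa [K, Submodule.topologicalClosure_coe] using h2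
  have : TopologicalSpace.SeparableSpace K := hsep.separableSpace
  let f : ℕ → WeakDual ℝ K := fun k =>
    StrongDual.toWeakDual (InnerProductSpace.toDual ℝ K ⟨x k, hxK k⟩)
  have hf : ∀ k, f k ∈ (WeakDual.toStrongDual ⁻¹' Metric.closedBall (0 : StrongDual ℝ K) M :
      Set (WeakDual ℝ K)) := by
    intro k
    have : ‖InnerProductSpace.toDual ℝ K ⟨x k, hxK k⟩‖ ≤ M := by
      rw [LinearIsometryEquiv.norm_map]
      exact hM k
    exact mem_closedBall_zero_iff.2 this
  obtain ⟨g, -, φ, hφ, hlim⟩ := WeakDual.isSeqCompact_closedBall ℝ K 0 M hf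
  refine ⟨((InnerProductSpace.toDual ℝ K).symm (WeakDual.toStrongDual g) : K), φ, hφ, ?_⟩
  intro w
  have h1 := ((WeakDual.eval_continuous (K.orthogonalProjectionOnto w)).tendsto g).comp hlim
  have key : ∀ y : K, ⟪(y : H), w⟫_ℝ = ⟪y, K.orthogonalProjectionOnto w⟫_ℝ := by
    intro y
    exact (Submodule.inner_orthogonalProjectionOnto_eq_of_mem_left y w).symm
  have h2 : ∀ k, ⟪x (φ k), w⟫_ℝ = f (φ k) (K.orthogonalProjectionOnto w) := by
    intro k
    rw [key ⟨x (φ k), hxK _⟩]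
    rfl
  have h3 : ⟪(((InnerProductSpace.toDual ℝ K).symm (WeakDual.toStrongDual g) : K) : H), w⟫_ℝ
      = g (K.orthogonalProjectionOnto w) := by
    rw [key, InnerProductSpace.toDual_symm_apply]
    rfl
  rw [h3]
  simp only [h2]
  exact h1

theorem real_step_sum (r s : ℕ → ℝ) (N : ℕ) (h : ∀ k, N ≤ k → r (k + 1) ≤ r k + s k) (n : ℕ)
    (hn : N ≤ n) : r n + ∑ k ∈ Finset.range N, s k ≤ r N + ∑ k ∈ Finset.range n, s k := by
  induction n, hn using Nat.le_induction with
  | base => exact le_rfl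
  | succ n hn ih => rw [Finset.sum_range_succ]; linarith [h n hn]

theorem real_bdd (r s : ℕ → ℝ) (hs0 : ∀ k, 0 ≤ s k) (hs : Summable s)
    (h : ∀ k, r (k + 1) ≤ r k + s k) (n : ℕ) : r n ≤ r 0 + ∑' k, s k := by
  have h1 := real_step_sum r s 0 (fun k _ => h k) n (Nat.zero_le _)
  have h2 := hs.sum_le_tsum (Finset.range n) (fun i _ => hs0 i)
  simp at h1
  linarith

theorem real_tendsto (r s w V t : ℕ → ℝ) (hr0 : ∀ k, 0 ≤ r k) (hs0 : ∀ k, 0 ≤ s k)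
    (hs : Summable s) (hrs : ∀ᶠ k in atTop, r (k + 1) ≤ r k + s k)
    (hw0 : ∀ k, 0 ≤ w k) (hw : Tendsto (fun n => ∑ k ∈ Finset.range n, w k) atTop atTop)
    (hV0 : ∀ k, 0 ≤ V k) (ht0 : ∀ k, 0 ≤ t k) (ht : Summable t)
    (hV : ∀ k, V (k + 1) + w k * r k ^ 2 ≤ V k + t k) :
    Tendsto r atTop (nhds 0) := by
  obtain ⟨N0, hN0⟩ := eventually_atTop.1 hrs
  rw [Metric.tendsto_atTop]
  intro η' hη'
  obtain ⟨η, hη, hηη⟩ : ∃ η : ℝ, 0 < η ∧ η' = 2 * η := ⟨η' / 2, by linarith, by ring⟩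
  have htail : ∀ᶠ n in atTop, ∑' k, s k - η < ∑ k ∈ Finset.range n, s k :=
    (hs.hasSum.tendsto_sum_nat).eventually (lt_mem_nhds (by linarith))
  obtain ⟨N1, hN1⟩ := eventually_atTop.1 htail
  set N := max N0 N1 with hN
  have hex : ∃ k, N ≤ k ∧ r k < η := by
    by_contra hcon
    push Not at hcon
    have hb : ∀ n, N ≤ n → V n + η ^ 2 * ∑ k ∈ Finset.range n, w k
        ≤ V N + η ^ 2 * ∑ k ∈ Finset.range N, w k + ∑' k, t k := by
      intro n hn
      have h1 := real_step_sum V (fun k => t k - η ^ 2 * w k) N (by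
        intro k hk
        have h2 : η ^ 2 ≤ r k ^ 2 := pow_le_pow_left₀ hη.le (hcon k hk) 2
        have h3 := mul_le_mul_of_nonneg_left h2 (hw0 k)
        have := hV k
        linarith) n hn
      simp only [Finset.sum_sub_distrib, ← Finset.mul_sum] at h1
      have h4 := ht.sum_le_tsum (Finset.range n) (fun i _ => ht0 i)
      have h5 : 0 ≤ ∑ k ∈ Finset.range N, t k := Finset.sum_nonneg (fun i _ => ht0 i)
      linarith
    set B := V N + η ^ 2 * ∑ k ∈ Finset.range N, w k + ∑' k, t k
    obtain ⟨n, hn, hnN⟩ := ((hw.eventually_gt_atTop (B / η ^ 2)).and (eventually_ge_atTop N)).exists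
    have h6 := hb n hnN
    rw [div_lt_iff₀ (by positivity)] at hn
    linarith [hV0 n]
  obtain ⟨k, hk, hrk⟩ := hex
  refine ⟨k, fun n hn => ?_⟩
  have h1 := real_step_sum r s k (fun j hj => hN0 j (by omega)) n hn
  have h2 := hs.sum_le_tsum (Finset.range n) (fun i _ => hs0 i)
  have h3 := hN1 k (by omega)
  rw [Real.dist_eq, sub_zero, abs_of_nonneg (hr0 n)]
  linarith

section hilbert
variable {H : Type*} [NormedAddCommGroup H] [InnerProductSpace ℝ H]

/-- firm nonexpansiveness of `G = I - J`, in terms of the pairs. -/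
theorem firm_of_mono (A : H → Set H)
    (hmono : ∀ x y xu yv : H, xu ∈ A x → yv ∈ A y → 0 ≤ ⟪x - y, xu - yv⟫_ℝ)
    (J : ℝ → H → H)
    (hJ : ∀ c : ℝ, 0 < c → ∀ x : H, (1 / c) • (x - J c x) ∈ A (J c x))
    (c : ℝ) (hc : 0 < c) (x y : H) :
    ‖(x - J c x) - (y - J c y)‖ ^ 2 ≤ ⟪x - y, (x - J c x) - (y - J c y)⟫_ℝ := by
  have h := hmono _ _ _ _ (hJ c hc x) (hJ c hc y)
  rw [← smul_sub, inner_smul_right] at h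
  have h2 : 0 ≤ ⟪J c x - J c y, (x - J c x) - (y - J c y)⟫_ℝ := by
    by_contra hneg
    push Not at hneg
    have := mul_neg_of_pos_of_neg (one_div_pos.2 hc) hneg
    linarith
  have h3 : J c x - J c y = (x - y) - ((x - J c x) - (y - J c y)) := by abel
  rw [h3, inner_sub_left, real_inner_self_eq_norm_sq] at h2
  linarith

theorem norm_le_of_sq_le_inner (a b : H) (h : ‖a‖ ^ 2 ≤ ⟪b, a⟫_ℝ) : ‖a‖ ≤ ‖b‖ := by
  have h1 := real_inner_le_norm b a
  rcases (norm_nonneg a).eq_or_lt with h0 | h0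
  · rw [← h0]; positivity
  · nlinarith

theorem resolvent_param (A : H → Set H)
    (hmono : ∀ x y xu yv : H, xu ∈ A x → yv ∈ A y → 0 ≤ ⟪x - y, xu - yv⟫_ℝ)
    (J : ℝ → H → H)
    (hJ : ∀ c : ℝ, 0 < c → ∀ x : H, (1 / c) • (x - J c x) ∈ A (J c x))
    (c d : ℝ) (hc : 0 < c) (hd : 0 < d) (x : H) :
    ‖(x - J d x) - (x - J c x)‖ ≤ |d - c| / c * ‖x - J c x‖ := by
  have h := hmono _ _ _ _ (hJ c hc x) (hJ d hd x)
  have h3 : J c x - J d x = (x - J d x) - (x - J c x) := by abel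
  rw [h3] at h
  generalize x - J c x = g at *
  generalize x - J d x = g' at *
  have h4 : 0 ≤ ⟪g' - g, ((d - c) / c) • g - (g' - g)⟫_ℝ := by
    have h5 : ((d - c) / c) • g - (g' - g) = d • ((1 / c) • g - (1 / d) • g') := by
      rw [smul_sub, smul_smul, smul_smul, mul_one_div_cancel hd.ne',
        show (d - c) / c = d * (1 / c) - 1 by field_simp, sub_smul]
      module
    rw [h5, inner_smul_right]
    positivity
  rw [inner_sub_right, real_inner_self_eq_norm_sq, real_inner_comm] at h4
  have := norm_le_of_sq_le_inner (g' - g) (((d - c) / c) • g) (by linarith)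
  rwa [norm_smul, Real.norm_eq_abs, abs_div, abs_of_pos hc] at this

theorem step_norm (a b : H) (γ : ℝ) (h0 : 0 ≤ γ) (h2 : γ ≤ 2)
    (h : ‖b - a‖ ^ 2 ≤ ⟪-(γ • a), b - a⟫_ℝ) : ‖b‖ ≤ ‖a‖ := by
  rcases h0.eq_or_lt with h0 | h0
  · rw [← h0] at h
    have : ‖b - a‖ = 0 := by
      simp at h
      simp [h]
    rw [norm_eq_zero, sub_eq_zero] at this
    rw [this]
  · rw [norm_sub_sq_real, inner_neg_left, inner_smul_left, inner_sub_right,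
      real_inner_self_eq_norm_sq, real_inner_comm b a] at h
    simp only [conj_trivial] at h
    rw [real_inner_comm] at h
    have h1 := real_inner_le_norm a b
    have h3 : (2 - γ) * ⟪a, b⟫_ℝ ≤ (2 - γ) * (‖a‖ * ‖b‖) :=
      mul_le_mul_of_nonneg_left h1 (by linarith)
    have h4 : (2 - γ) * (2 * (‖a‖ * ‖b‖)) ≤ (2 - γ) * (‖a‖ ^ 2 + ‖b‖ ^ 2) :=
      mul_le_mul_of_nonneg_left (by nlinarith [sq_nonneg (‖a‖ - ‖b‖)]) (by linarith)
    have h5 : γ * ‖b‖ ^ 2 ≤ γ * ‖a‖ ^ 2 := by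
      rw [real_inner_comm] at h
      rw [real_inner_comm] at h3
      nlinarith
    have h6 := le_of_mul_le_mul_left h5 h0
    exact (sq_le_sq₀ (norm_nonneg _) (norm_nonneg _)).1 h6

theorem relax_norm (y a : H) (β γ : ℝ) (h1 : 0 ≤ γ * (β + γ)) (h2 : |β + γ| ≤ 1)
    (h : ‖a‖ ^ 2 ≤ ⟪y, a⟫_ℝ) :
    ‖(β + γ) • y - γ • a‖ ^ 2 + γ * (2 * β + γ) * ‖a‖ ^ 2 ≤ ‖y‖ ^ 2 := by
  rw [norm_sub_sq_real, norm_smul, norm_smul, inner_smul_left, inner_smul_right, mul_pow, mul_pow,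
    Real.norm_eq_abs, Real.norm_eq_abs, sq_abs, sq_abs]
  simp only [conj_trivial]
  have h3 : (β + γ) ^ 2 ≤ 1 := by
    rw [← sq_abs]; exact pow_le_one₀ (abs_nonneg _) h2
  have h4 := mul_le_mul_of_nonneg_left h h1
  have h5 := mul_le_mul_of_nonneg_right h3 (sq_nonneg ‖y‖)
  nlinarith

end hilbert

/-- Proposition 3.9: under the stated parameter conditions, `x_k - J_{c_k}(x_k) → 0` and the
set of weak sequential cluster points of `(x_k)` is nonempty and contained in `zer A`. -/
theorem stmt13 {H : Type*} [NormedAddCommGroup H] [InnerProductSpace ℝ H] [CompleteSpace H]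
    (A : H → Set H)
    (hmono : ∀ x y xu yv : H, xu ∈ A x → yv ∈ A y → 0 ≤ ⟪x - y, xu - yv⟫_ℝ)
    (hmax : ∀ x xu : H, (∀ y yv : H, yv ∈ A y → 0 ≤ ⟪x - y, xu - yv⟫_ℝ) → xu ∈ A x)
    (J : ℝ → H → H)
    (hJ : ∀ c : ℝ, 0 < c → ∀ x : H, (1 / c) • (x - J c x) ∈ A (J c x))
    (u : H) (e : ℕ → H) (c α β γ δ : ℕ → ℝ) (hc : ∀ k, 0 < c k)
    (x : ℕ → H)
    (hrec : ∀ k, x (k + 1) = α k • u + β k • x k + γ k • J (c k) (x k) + δ k • e k)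
    (ξ : ℕ → ℝ) (hξ : ∀ k, ξ k = |β k + γ k / 2| + |γ k / 2|)
    (hzer : ∃ p : H, (0 : H) ∈ A p)
    (hξ1 : ∀ k, ξ k ≤ 1)
    (hγβγ : ∀ k, 0 ≤ γ k * (β k + γ k))
    (hγ2βγ : ∀ k, 0 ≤ γ k * (2 * β k + γ k))
    (hmaxcond : ∀ k, |β k + γ k| * |γ k| ≤ max (1 - |β k|) (2 - 2 * |β k + γ k / 2|))
    (hαsum : Summable (fun k => |α k|))
    (hβγsum : Summable (fun k => |1 - β k - γ k|))
    (hγdiv : Tendsto (fun n => ∑ k ∈ Finset.range n, γ k * (2 * β k + γ k)) atTop atTop)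
    (hdesum : Summable (fun k => ‖δ k • e k‖))
    (hcinf : ∃ ε > (0 : ℝ), ∀ k, ε ≤ c k)
    (hcsum : Summable (fun k => |c (k + 1) - c k|)) :
    Tendsto (fun k => x k - J (c k) (x k)) atTop (nhds (0 : H)) ∧
      (∃ z : H, WSeqClusterPt x z) ∧
      ∀ z : H, WSeqClusterPt x z → (0 : H) ∈ A z := by
  obtain ⟨p, hp⟩ := hzer
  obtain ⟨ε, hε, hcε⟩ := hcinf
  have firm := firm_of_mono A hmono J hJ
  have hJp : ∀ d, 0 < d → J d p = p := by
    intro d hd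
    have h := hmono _ _ _ _ (hJ d hd p) hp
    rw [sub_zero, inner_smul_right, ← neg_sub p (J d p), inner_neg_left,
      real_inner_self_eq_norm_sq] at h
    have h1 : 0 < 1 / d := one_div_pos.2 hd
    have h2 : ‖p - J d p‖ ^ 2 ≤ 0 := by
      by_contra hcon
      push Not at hcon
      have := mul_pos h1 hcon
      linarith
    have h3 : ‖p - J d p‖ = 0 := by
      have := sq_nonneg ‖p - J d p‖
      exact pow_eq_zero_iff two_ne_zero |>.1 (le_antisymm h2 this)
    rw [norm_eq_zero, sub_eq_zero] at h3
    exact h3.symm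
  have firmp : ∀ d, 0 < d → ∀ y, ‖y - J d y‖ ^ 2 ≤ ⟪y - p, y - J d y⟫_ℝ := by
    intro d hd y
    have := firm d hd y p
    rwa [hJp d hd, sub_self, sub_zero] at this
  let a : ℕ → H := fun k => x k - J (c k) (x k)
  let v : ℕ → H := fun k => (β k + γ k) • (x k - p) - γ k • a k
  let h : ℕ → H := fun k => α k • u + δ k • e k - (1 - β k - γ k) • p
  have hstep : ∀ k, x (k + 1) - p = v k + h k := by
    intro k
    rw [hrec k]
    simp only [v, h, a]
    module
  have hbg : ∀ k, |β k + γ k| ≤ 1 := by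
    intro k
    have h1 := hξ1 k
    rw [hξ k] at h1
    have h2 := abs_add_le (β k + γ k / 2) (γ k / 2)
    rw [show β k + γ k / 2 + γ k / 2 = β k + γ k by ring] at h2
    linarith
  have hrel : ∀ k, ‖v k‖ ^ 2 + γ k * (2 * β k + γ k) * ‖a k‖ ^ 2 ≤ ‖x k - p‖ ^ 2 :=
    fun k => relax_norm _ _ _ _ (hγβγ k) (hbg k) (firmp _ (hc k) (x k))
  have hv : ∀ k, ‖v k‖ ≤ ‖x k - p‖ := by
    intro k
    have h1 := hrel k
    have h2 := mul_nonneg (hγ2βγ k) (sq_nonneg ‖a k‖)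
    exact (sq_le_sq₀ (norm_nonneg _) (norm_nonneg _)).1 (by linarith)
  have hhsum : Summable (fun k => ‖h k‖) := by
    have h1 : Summable (fun k => |α k| * ‖u‖ + ‖δ k • e k‖ + |1 - β k - γ k| * ‖p‖) :=
      ((hαsum.mul_right _).add hdesum).add (hβγsum.mul_right _)
    refine Summable.of_nonneg_of_le (fun k => norm_nonneg _) (fun k => ?_) h1
    refine (norm_sub_le _ _).trans ?_
    rw [norm_smul (1 - β k - γ k), Real.norm_eq_abs]
    gcongr
    refine (norm_add_le _ _).trans ?_
    rw [norm_smul (α k), Real.norm_eq_abs]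
  obtain ⟨M, hM⟩ : ∃ M, ∀ k, ‖x k - p‖ ≤ M :=
    ⟨_, real_bdd (fun k => ‖x k - p‖) (fun k => ‖h k‖) (fun k => norm_nonneg _) hhsum (by
      intro k
      rw [hstep k]
      linarith [norm_add_le (v k) (h k), hv k])⟩
  have hM0 : 0 ≤ M := (norm_nonneg _).trans (hM 0)
  let q : ℕ → H := fun k => α k • u + δ k • e k - (1 - β k - γ k) • x k
  have hqstep : ∀ k, x (k + 1) = (x k - γ k • a k) + q k := by
    intro k
    rw [hrec k]
    simp only [q, a]
    module
  have hqsum : Summable (fun k => ‖q k‖) := by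
    have h1 : Summable (fun k => ‖h k‖ + |1 - β k - γ k| * M) :=
      hhsum.add (hβγsum.mul_right _)
    refine Summable.of_nonneg_of_le (fun k => norm_nonneg _) (fun k => ?_) h1
    have h2 : q k = h k - (1 - β k - γ k) • (x k - p) := by
      simp only [q, h]
      module
    rw [h2]
    refine (norm_sub_le _ _).trans ?_
    rw [norm_smul (1 - β k - γ k), Real.norm_eq_abs]
    gcongr
    exact hM k
  have hγev : ∀ᶠ k in atTop, 0 ≤ γ k := by
    filter_upwards [hβγsum.tendsto_atTop_zero.eventually (gt_mem_nhds one_pos)] with k hk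
    have h1 := (abs_lt.1 hk).2
    have h2 : 0 < β k + γ k := by linarith
    exact nonneg_of_mul_nonneg_left (hγβγ k) h2
  have hγ2 : ∀ k, γ k ≤ 2 := by
    intro k
    have h1 := hξ1 k
    rw [hξ k] at h1
    linarith [abs_nonneg (β k + γ k / 2), le_abs_self (γ k / 2)]
  have hamon : ∀ᶠ k in atTop, ‖a (k + 1)‖ ≤ ‖a k‖ + (‖q k‖ + |c (k + 1) - c k| * (M / ε)) := by
    filter_upwards [hγev] with k hk
    let m : H := x (k + 1) - J (c k) (x (k + 1))
    let y : H := x k - γ k • a k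
    let b : H := y - J (c k) y
    have h1 : ‖a (k + 1) - m‖ ≤ |c (k + 1) - c k| / c k * ‖m‖ :=
      resolvent_param A hmono J hJ (c k) (c (k + 1)) (hc k) (hc _) (x (k + 1))
    have h2 : ‖m‖ ≤ M :=
      (norm_le_of_sq_le_inner _ _ (firmp _ (hc k) (x (k + 1)))).trans (hM _)
    have h3 : ‖m - b‖ ≤ ‖q k‖ := by
      have := norm_le_of_sq_le_inner _ _ (firm _ (hc k) (x (k + 1)) y)
      rwa [show x (k + 1) - y = q k by rw [hqstep k]; simp only [y]; abel] at this
    have h4 : ‖b‖ ≤ ‖a k‖ := by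
      refine step_norm (a k) b (γ k) hk (hγ2 k) ?_
      have := firm _ (hc k) y (x k)
      rwa [show y - x k = -(γ k • a k) by simp only [y]; abel] at this
    have h5 : |c (k + 1) - c k| / c k * ‖m‖ ≤ |c (k + 1) - c k| * (M / ε) := by
      rw [div_mul_eq_mul_div, mul_div_assoc]
      gcongr
      exact hcε k
    have h6 := norm_sub_norm_le (a (k + 1)) m
    have h7 := norm_sub_norm_le m b
    linarith
  have hanorm : Tendsto (fun k => ‖a k‖) atTop (nhds 0) := by
    refine real_tendsto (fun k => ‖a k‖) (fun k => ‖q k‖ + |c (k + 1) - c k| * (M / ε))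
      (fun k => γ k * (2 * β k + γ k)) (fun k => ‖x k - p‖ ^ 2) (fun k => 4 * M * ‖h k‖)
      (fun k => norm_nonneg _) (fun k => by positivity)
      (hqsum.add (hcsum.mul_right _)) hamon hγ2βγ hγdiv (fun k => by positivity)
      (fun k => by positivity) (hhsum.mul_left _) ?_
    intro k
    have h1 := hrel k
    have h2 : ‖x (k + 1) - p‖ ≤ ‖v k‖ + ‖h k‖ := by
      rw [hstep k]; exact norm_add_le _ _
    have h3 : ‖v k‖ ≤ M := (hv k).trans (hM k)
    have h4 := hM (k + 1)
    have h5 := norm_nonneg (h k)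
    have h6 : ‖x (k + 1) - p‖ ^ 2 - ‖v k‖ ^ 2 ≤ 2 * M * ‖h k‖ := by
      have h7 : 0 ≤ ‖x (k + 1) - p‖ + ‖v k‖ := by positivity
      have h8 : (‖x (k + 1) - p‖ - ‖v k‖) * (‖x (k + 1) - p‖ + ‖v k‖)
          ≤ ‖h k‖ * (‖x (k + 1) - p‖ + ‖v k‖) :=
        mul_le_mul_of_nonneg_right (by linarith) h7
      have h9 : ‖h k‖ * (‖x (k + 1) - p‖ + ‖v k‖) ≤ ‖h k‖ * (2 * M) :=
        mul_le_mul_of_nonneg_left (by linarith) h5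
      linarith
    have h10 := mul_nonneg hM0 h5
    linarith
  have ha0 : Tendsto a atTop (nhds 0) := tendsto_zero_iff_norm_tendsto_zero.2 hanorm
  have hxb : ∀ k, ‖x k‖ ≤ M + ‖p‖ := by
    intro k
    have := norm_sub_norm_le (x k) p
    linarith [hM k]
  refine ⟨ha0, exists_weak_cluster x _ hxb, ?_⟩
  rintro z ⟨φ, hφ, hz⟩
  apply hmax
  intro y yv hyv
  have haφ : Tendsto (fun k => ‖a (φ k)‖) atTop (nhds 0) := hanorm.comp hφ.tendsto_atTop
  have hineq : ∀ k, 0 ≤ ‖a (φ k)‖ * ((3 * M + 2 * ‖p‖ + ‖y‖) / ε + ‖yv‖)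
      - (⟪x (φ k), yv⟫_ℝ - ⟪y, yv⟫_ℝ) := by
    intro k
    set n := φ k
    have h1 := hmono _ _ _ _ (hJ (c n) (hc n) (x n)) hyv
    have h2 : J (c n) (x n) = x n - a n := by simp only [a]; abel
    rw [inner_sub_right, inner_smul_right] at h1
    have h3 : ⟪J (c n) (x n) - y, yv⟫_ℝ = ⟪x n, yv⟫_ℝ - ⟪a n, yv⟫_ℝ - ⟪y, yv⟫_ℝ := by
      rw [h2, inner_sub_left, inner_sub_left]
    have h4 : ⟪a n, yv⟫_ℝ ≤ ‖a n‖ * ‖yv‖ := real_inner_le_norm _ _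
    have ham : ‖a n‖ ≤ M := (norm_le_of_sq_le_inner _ _ (firmp _ (hc n) (x n))).trans (hM n)
    have h5 : ‖J (c n) (x n) - y‖ ≤ 3 * M + 2 * ‖p‖ + ‖y‖ := by
      rw [h2]
      have e1 := norm_sub_le (x n - a n) y
      have e2 := norm_sub_le (x n) (a n)
      linarith [hxb n, norm_nonneg p]
    have h6 : 1 / c n * ⟪J (c n) (x n) - y, x n - J (c n) (x n)⟫_ℝ
        ≤ ‖a n‖ * ((3 * M + 2 * ‖p‖ + ‖y‖) / ε) := by
      have e1 : ⟪J (c n) (x n) - y, x n - J (c n) (x n)⟫_ℝ ≤ (3 * M + 2 * ‖p‖ + ‖y‖) * ‖a n‖ :=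
        (real_inner_le_norm _ _).trans (mul_le_mul_of_nonneg_right h5 (norm_nonneg _))
      have e2 : 1 / c n ≤ 1 / ε := one_div_le_one_div_of_le hε (hcε n)
      have e3 : 0 ≤ 1 / c n := (one_div_pos.2 (hc n)).le
      calc _ ≤ 1 / c n * ((3 * M + 2 * ‖p‖ + ‖y‖) * ‖a n‖) := mul_le_mul_of_nonneg_left e1 e3
        _ ≤ 1 / ε * ((3 * M + 2 * ‖p‖ + ‖y‖) * ‖a n‖) :=
          mul_le_mul_of_nonneg_right e2 (by positivity)
        _ = _ := by ring
    rw [h3] at h1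
    linarith
  have hlim : Tendsto (fun k => ‖a (φ k)‖ * ((3 * M + 2 * ‖p‖ + ‖y‖) / ε + ‖yv‖)
      - (⟪x (φ k), yv⟫_ℝ - ⟪y, yv⟫_ℝ)) atTop
      (nhds (0 * ((3 * M + 2 * ‖p‖ + ‖y‖) / ε + ‖yv‖) - (⟪z, yv⟫_ℝ - ⟪y, yv⟫_ℝ))) :=
    (haφ.mul_const _).sub ((hz yv).sub_const _)
  have hfin := ge_of_tendsto' hlim hineq
  rw [zero_sub, inner_neg_right, inner_sub_left]
  linarith
end

section
/- Suppose that zer A ≠ ∅, that the sequence (x_k)_{k∈ℕ} is bounded and every weak sequential cluster point of (x_k) belongs to zer A, that for every k ∈ ℕ, ξ_k ≤ 1 with ∑_k (1 − ξ_k²) = ∞, and that one of the following holds: (1) for every k, β_k + γ_k ≥ 0 and ξ_k² − β_k − γ_k ≤ 0, ∑_k |1 − α_k − β_k − γ_k| < ∞, and ∑_k ‖δ_k e_k‖ < ∞; (2) for every k, ξ_k < 1, sup_k (1 − β_k − γ_k)/(1 − ξ_k²) < ∞, ∑_k |1 − α_k − β_k − γ_k| < ∞, and ∑_k ‖δ_k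 e_k‖ < ∞; (3) for every k, α_k ∈ [0,1] and α_k + ξ_k² ≤ 1, ∑_k |1 − α_k − β_k − γ_k| < ∞, and ∑_k ‖δ_k e_k‖ < ∞; (4) for every k, ξ_k < 1 and α_k ≥ 0, sup_k α_k/(1 − ξ_k²) < ∞, ∑_k |1 − α_k − β_k − γ_k| < ∞, and ∑_k ‖δ_k e_k‖ < ∞; (5) for every k, α_k ∈ (0,1] and α_k + ξ_k² ≤ 1, δ_k e_k/α_k → 0, and (1 − α_k − β_k − γ_k)/α_k → 0; (6) for every k, ξ_k < 1 and α_k > 0, sup_k α_k/(1 − ξ_k²) < ∞, δ_k e_k/α_k → 0, and (1 − α_k − β_k − γ_k)/α_k → 0. Then x_k converges strongly to P_{zer A} u. -/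
open Filter InnerProductSpace

theorem weak_compact_aux {H : Type*} [NormedAddCommGroup H] [InnerProductSpace ℝ H]
    [CompleteSpace H] (y : ℕ → H) (M : ℝ) (hM : ∀ k, ‖y k‖ ≤ M) :
    ∃ z, WSeqClusterPt y z := by
  let V : Submodule ℝ H := (Submodule.span ℝ (Set.range y)).topologicalClosure
  have hVc : IsClosed (V : Set H) := Submodule.isClosed_topologicalClosure _
  haveI : CompleteSpace V := hVc.completeSpace_coe
  have hsep : TopologicalSpace.IsSeparable (V : Set H) := by
    have h1 : TopologicalSpace.IsSeparable (Set.range y) := (Set.countable_range y).isSeparable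
    have h2 := (h1.span (R := ℝ)).closure
    exact h2
  haveI : TopologicalSpace.SeparableSpace V := hsep.separableSpace
  have hmem : ∀ k, y k ∈ V := fun k =>
    Submodule.le_topologicalClosure _ (Submodule.subset_span ⟨k, rfl⟩)
  let y' : ℕ → V := fun k => ⟨y k, hmem k⟩
  let f : ℕ → WeakDual ℝ V := fun k => StrongDual.toWeakDual (InnerProductSpace.toDual ℝ V (y' k))
  have hf : ∀ k, f k ∈ WeakDual.toStrongDual ⁻¹' Metric.closedBall (0 : StrongDual ℝ V) M := by
    intro k
    have : ‖InnerProductSpace.toDual ℝ V (y' k)‖ ≤ M := by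
      rw [LinearIsometryEquiv.norm_map]; exact hM k
    show dist (InnerProductSpace.toDual ℝ V (y' k)) 0 ≤ M
    rwa [dist_zero_right]
  obtain ⟨g, -, φ, hφ, hlim⟩ := WeakDual.isSeqCompact_closedBall ℝ V 0 M hf
  let z : V := (InnerProductSpace.toDual ℝ V).symm (WeakDual.toStrongDual g)
  refine ⟨z, φ, hφ, fun w => ?_⟩
  have hl := (tendsto_iff_forall_eval_tendsto_topDualPairing.1 hlim) (V.orthogonalProjection w)
  have e1 : ∀ v : V, ⟪(v : H), w⟫_ℝ = ⟪v, V.orthogonalProjection w⟫_ℝ := by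
    intro v
    exact (Submodule.inner_orthogonalProjection_eq_of_mem_left v w).symm
  have e2 : topDualPairing ℝ V g (V.orthogonalProjection w) = ⟪(z : H), w⟫_ℝ := by
    rw [e1]
    simp only [z, InnerProductSpace.toDual_symm_apply]
    rfl
  have e3 : ∀ k, topDualPairing ℝ V ((f ∘ φ) k) (V.orthogonalProjection w)
      = ⟪y (φ k), w⟫_ℝ := by
    intro k
    exact (e1 (y' (φ k))).symm
  rw [e2] at hl
  simpa only [e3] using hl

theorem limsup_aux {H : Type*} [NormedAddCommGroup H] [InnerProductSpace ℝ H]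
    [CompleteSpace H] (x : ℕ → H) (M : ℝ) (hM : ∀ k, ‖x k‖ ≤ M) (w p : H)
    (h : ∀ z, WSeqClusterPt x z → ⟪w, z - p⟫_ℝ ≤ 0) :
    Tendsto (fun k => max ⟪w, x k - p⟫_ℝ 0) atTop (nhds 0) := by
  have key : ∀ ε > 0, ∀ᶠ k in atTop, ⟪w, x k - p⟫_ℝ < ε := by
    intro ε hε
    by_contra hcon
    have hfr : ∃ᶠ k in atTop, ε ≤ ⟪w, x k - p⟫_ℝ := by
      simpa [Filter.Frequently] using hcon
    obtain ⟨φ, hφ, hφ2⟩ := extraction_of_frequently_atTop hfr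
    obtain ⟨z, ψ, hψ, hlim⟩ := weak_compact_aux (fun k => x (φ k)) M (fun k => hM _)
    have hz := h z ⟨φ ∘ ψ, hφ.comp hψ, hlim⟩
    have hw := (hlim w).sub_const ⟪p, w⟫_ℝ
    have : ε ≤ ⟪z, w⟫_ℝ - ⟪p, w⟫_ℝ := by
      refine ge_of_tendsto' hw fun k => ?_
      have := hφ2 (ψ k)
      rwa [real_inner_comm, inner_sub_left] at this
    rw [real_inner_comm, inner_sub_left] at hz
    linarith
  rw [Metric.tendsto_atTop']
  intro ε hε
  obtain ⟨N, hN⟩ := eventually_atTop.1 (key ε hε)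
  refine ⟨N, fun n hn => ?_⟩
  rw [Real.dist_eq, sub_zero, abs_of_nonneg (le_max_right _ _)]
  exact max_lt (hN n hn.le) hε

theorem xu_aux (s l b ε : ℕ → ℝ) (hs : ∀ k, 0 ≤ s k) (hl0 : ∀ k, 0 ≤ l k) (hl1 : ∀ k, l k ≤ 1)
    (hdiv : Tendsto (fun n => ∑ k ∈ Finset.range n, l k) atTop atTop)
    (hb : Tendsto b atTop (nhds 0)) (hε0 : ∀ k, 0 ≤ ε k) (hε : Summable ε)
    (h : ∀ k, s (k + 1) ≤ (1 - l k) * s k + l k * b k + ε k) :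
    Tendsto s atTop (nhds 0) := by
  have key : ∀ η > 0, ∀ᶠ n in atTop, s n < η := by
    intro η hη
    have h1 : ∀ᶠ n in atTop, b n < η / 3 := hb.eventually_lt_const (by positivity)
    have h2 := (tendsto_sum_nat_add ε).eventually_lt_const (show (0 : ℝ) < η / 3 by positivity)
    obtain ⟨N1, hN1⟩ := eventually_atTop.1 h1
    obtain ⟨N2, hN2⟩ := eventually_atTop.1 h2
    let N := max N1 N2
    have hbN : ∀ k, b (k + N) ≤ η / 3 := fun k =>
      (hN1 (k + N) (le_trans (le_max_left _ _) (Nat.le_add_left _ _))).le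
    have hsN : ∀ n, ∑ k ∈ Finset.range n, ε (k + N) ≤ η / 3 := fun n =>
      (((summable_nat_add_iff N).2 hε).sum_le_tsum _ (fun i _ => hε0 _)).trans
        (hN2 N (le_max_right _ _)).le
    have ind : ∀ n, s (n + N) ≤ Real.exp (-∑ k ∈ Finset.range n, l (k + N)) * s N + η / 3
        + ∑ k ∈ Finset.range n, ε (k + N) := by
      intro n
      induction n with
      | zero => simp; positivity
      | succ n ih =>
        have h3 := h (n + N)
        have h4 : (1 - l (n + N)) * s (n + N) ≤ (1 - l (n + N)) *
          (Real.exp (-∑ k ∈ Finset.range n, l (k + N)) * s N + η / 3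
            + ∑ k ∈ Finset.range n, ε (k + N)) :=
          mul_le_mul_of_nonneg_left ih (by linarith [hl1 (n + N)])
        have h5 : l (n + N) * b (n + N) ≤ l (n + N) * (η / 3) :=
          mul_le_mul_of_nonneg_left (hbN n) (hl0 _)
        have h6 : 1 - l (n + N) ≤ Real.exp (-l (n + N)) := Real.one_sub_le_exp_neg _
        have h7 : 0 ≤ Real.exp (-∑ k ∈ Finset.range n, l (k + N)) * s N :=
          mul_nonneg (Real.exp_pos _).le (hs _)
        have h8 := mul_le_mul_of_nonneg_right h6 h7
        have h9 : 0 ≤ l (n + N) * ∑ k ∈ Finset.range n, ε (k + N) :=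
          mul_nonneg (hl0 _) (Finset.sum_nonneg fun i _ => hε0 _)
        rw [Finset.sum_range_succ, Finset.sum_range_succ, neg_add, Real.exp_add,
          show n + 1 + N = n + N + 1 by ring]
        nlinarith
    have hdiv' : Tendsto (fun n => ∑ k ∈ Finset.range n, l (k + N)) atTop atTop := by
      have h3 := (tendsto_add_atTop_iff_nat N).2 hdiv
      have h4 := tendsto_atTop_add_const_right atTop (-∑ k ∈ Finset.range N, l k) h3
      refine h4.congr fun n => ?_
      rw [add_comm n N, Finset.sum_range_add]
      simp [add_comm]
    have h5 : Tendsto (fun n => Real.exp (-∑ k ∈ Finset.range n, l (k + N)) * s N) atTop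
        (nhds 0) := by
      have := (Real.tendsto_exp_neg_atTop_nhds_zero.comp hdiv').mul_const (s N)
      simpa using this
    obtain ⟨K, hK⟩ := eventually_atTop.1
      (h5.eventually_lt_const (show (0 : ℝ) < η / 3 by positivity))
    refine eventually_atTop.2 ⟨K + N, fun n hn => ?_⟩
    obtain ⟨m, rfl⟩ : ∃ m, n = m + N := ⟨n - N, by omega⟩
    have := hK m (by omega)
    linarith [ind m, hsN m]
  rw [Metric.tendsto_atTop']
  intro η hη
  obtain ⟨N, hN⟩ := eventually_atTop.1 (key η hη)
  refine ⟨N, fun n hn => ?_⟩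
  rw [Real.dist_eq, sub_zero, abs_of_nonneg (hs n)]
  exact hN n hn.le

theorem proj_aux {H : Type*} [NormedAddCommGroup H] [InnerProductSpace ℝ H] [CompleteSpace H]
    (A : H → Set H)
    (hmono : ∀ x y xu yv : H, xu ∈ A x → yv ∈ A y → 0 ≤ ⟪x - y, xu - yv⟫_ℝ)
    (hmax : ∀ x xu : H, (∀ y yv : H, yv ∈ A y → 0 ≤ ⟪x - y, xu - yv⟫_ℝ) → xu ∈ A x)
    (hzer : ∃ p : H, (0 : H) ∈ A p) (u : H) :
    ∃ p : H, (0 : H) ∈ A p ∧ (∀ z : H, (0 : H) ∈ A z → ⟪u - p, z - p⟫_ℝ ≤ 0) := by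
  let K : Set H := {z | (0 : H) ∈ A z}
  have hK : K = ⋂ (y : H) (v : H) (_ : v ∈ A y), {z | 0 ≤ ⟪z - y, 0 - v⟫_ℝ} := by
    ext z
    simp only [K, Set.mem_setOf_eq, Set.mem_iInter]
    exact ⟨fun hz y v hv => hmono _ _ _ _ hz hv, fun hz => hmax _ _ hz⟩
  have hcl : IsClosed K := by
    rw [hK]
    refine isClosed_iInter fun y => isClosed_iInter fun v => isClosed_iInter fun _ => ?_
    exact isClosed_le continuous_const (by fun_prop)
  have hconv : Convex ℝ K := by
    rw [hK]
    refine convex_iInter fun y => convex_iInter fun v => convex_iInter fun _ => ?_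
    intro z1 h1 z2 h2 a b ha hb hab
    simp only [Set.mem_setOf_eq] at *
    have : a • z1 + b • z2 - y = a • (z1 - y) + b • (z2 - y) := by
      have : y = (a + b) • y := by rw [hab, one_smul]
      nth_rewrite 1 [this]
      module
    rw [this, inner_add_left, real_inner_smul_left, real_inner_smul_left]
    positivity
  obtain ⟨p, hp, hpn⟩ := exists_norm_eq_iInf_of_complete_convex hzer hcl.isComplete hconv u
  exact ⟨p, hp, (norm_eq_iInf_iff_real_inner_le_zero hconv hp).1 hpn⟩

theorem step_aux {H : Type*} [NormedAddCommGroup H] [InnerProductSpace ℝ H]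
    (x j p : H) (b g : ℝ) (h : 0 ≤ ⟪j - p, x - j⟫_ℝ) :
    ‖b • (x - p) + g • (j - p)‖ ≤ (|b + g / 2| + |g / 2|) * ‖x - p‖ := by
  have hN : ‖(j - p) - (x - j)‖ ≤ ‖x - p‖ := by
    have e1 := norm_sub_sq_real (j - p) (x - j)
    have e2 := norm_add_sq_real (j - p) (x - j)
    rw [show j - p + (x - j) = x - p by abel] at e2
    exact le_of_sq_le_sq (by linarith) (norm_nonneg _)
  have e : b • (x - p) + g • (j - p)
      = (b + g / 2) • (x - p) + (g / 2) • ((j - p) - (x - j)) := by module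
  rw [e]
  refine (norm_add_le _ _).trans ?_
  rw [norm_smul, norm_smul, Real.norm_eq_abs, Real.norm_eq_abs, add_mul]
  gcongr

theorem sq_aux {H : Type*} [NormedAddCommGroup H] [InnerProductSpace ℝ H]
    (y v w r : H) (a : ℝ) (h : y = v + a • w + r) :
    ‖y‖ ^ 2 ≤ ‖v‖ ^ 2 + 2 * a * ⟪w, y⟫_ℝ + 2 * (‖r‖ * ‖y‖) := by
  have hv : v = y - (a • w + r) := by rw [h]; abel
  have e := norm_sub_sq_real y (a • w + r)
  rw [← hv, real_inner_comm, inner_add_left, real_inner_smul_left] at e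
  have := real_inner_le_norm r y
  nlinarith [sq_nonneg ‖a • w + r‖]

theorem core_aux {H : Type*} [NormedAddCommGroup H] [InnerProductSpace ℝ H] [CompleteSpace H]
    (x : ℕ → H) (p u : H) (M : ℝ) (hM : ∀ k, ‖x k‖ ≤ M) (ξ : ℕ → ℝ) (hξ0 : ∀ k, 0 ≤ ξ k)
    (hξ1 : ∀ k, ξ k ≤ 1)
    (hξdiv : Tendsto (fun n => ∑ k ∈ Finset.range n, (1 - ξ k ^ 2)) atTop atTop)
    (hcl : ∀ z, WSeqClusterPt x z → ⟪u - p, z - p⟫_ℝ ≤ 0)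
    (v r : ℕ → H) (a t ε : ℕ → ℝ) (C : ℝ)
    (hv : ∀ k, ‖v k‖ ≤ ξ k * ‖x k - p‖)
    (hx : ∀ k, x (k + 1) - p = v k + a k • (u - p) + r k)
    (ha0 : ∀ k, 0 ≤ a k) (haC : ∀ k, a k ≤ C * (1 - ξ k ^ 2))
    (ht0 : ∀ k, 0 ≤ t k) (ht : Tendsto t atTop (nhds 0))
    (hε0 : ∀ k, 0 ≤ ε k) (hε : Summable ε)
    (hr : ∀ k, ‖r k‖ ≤ a k * t k + ε k) :
    Tendsto x atTop (nhds p) := by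
  have hlim := limsup_aux x M hM (u - p) p hcl
  set m : ℕ → ℝ := fun k => max ⟪u - p, x k - p⟫_ℝ 0 with hm
  have hlim' : Tendsto (fun k => m (k + 1)) atTop (nhds 0) := (tendsto_add_atTop_iff_nat 1).2 hlim
  set L := M + ‖p‖ with hL
  have hxp : ∀ k, ‖x k - p‖ ≤ L := fun k => (norm_sub_le _ _).trans (by linarith [hM k])
  have hL0 : 0 ≤ L := (norm_nonneg _).trans (hxp 0)
  have hsq : Tendsto (fun k => ‖x k - p‖ ^ 2) atTop (nhds 0) := by
    refine xu_aux (fun k => ‖x k - p‖ ^ 2) (fun k => 1 - ξ k ^ 2)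
      (fun k => 2 * C * (m (k + 1) + t k * L)) (fun k => 2 * L * ε k) (fun k => by positivity)
      (fun k => ?_) (fun k => ?_) hξdiv ?_ (fun k => ?_) (hε.mul_left _) (fun k => ?_)
    · nlinarith [hξ0 k, hξ1 k]
    · nlinarith [sq_nonneg (ξ k)]
    · simpa using (hlim'.add (ht.mul_const L)).const_mul (2 * C)
    · have := hε0 k
      positivity
    · have h1 := sq_aux _ _ _ _ _ (hx k)
      have h2 : ‖v k‖ ^ 2 ≤ ξ k ^ 2 * ‖x k - p‖ ^ 2 := by
        rw [← mul_pow]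
        exact pow_le_pow_left₀ (norm_nonneg _) (hv k) 2
      have h3 : ⟪u - p, x (k + 1) - p⟫_ℝ ≤ m (k + 1) := le_max_left _ _
      have hm0 : 0 ≤ m (k + 1) := le_max_right _ _
      have h4 := mul_le_mul_of_nonneg_left h3 (ha0 k)
      have h5 : ‖r k‖ * ‖x (k + 1) - p‖ ≤ (a k * t k + ε k) * L :=
        mul_le_mul (hr k) (hxp _) (norm_nonneg _) ((norm_nonneg _).trans (hr k))
      have h6 : a k * (m (k + 1) + t k * L) ≤ C * (1 - ξ k ^ 2) * (m (k + 1) + t k * L) :=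
        mul_le_mul_of_nonneg_right (haC k) (add_nonneg hm0 (mul_nonneg (ht0 k) hL0))
      nlinarith
  rw [tendsto_iff_norm_sub_tendsto_zero]
  have := hsq.sqrt
  simpa [Real.sqrt_sq] using this

/-- Proposition 4.3 (StrongConver): if `(x_k)` is bounded, every weak sequential cluster
point of `(x_k)` lies in `zer A`, `ξ_k ≤ 1` with `∑ (1 - ξ_k²) = ∞`, and one of the six
listed conditions holds, then `x_k → P_{zer A} u` strongly. -/
theorem stmt18 {H : Type*} [NormedAddCommGroup H] [InnerProductSpace ℝ H] [CompleteSpace H]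
    (A : H → Set H)
    (hmono : ∀ x y xu yv : H, xu ∈ A x → yv ∈ A y → 0 ≤ ⟪x - y, xu - yv⟫_ℝ)
    (hmax : ∀ x xu : H, (∀ y yv : H, yv ∈ A y → 0 ≤ ⟪x - y, xu - yv⟫_ℝ) → xu ∈ A x)
    (J : ℝ → H → H)
    (hJ : ∀ c : ℝ, 0 < c → ∀ x : H, (1 / c) • (x - J c x) ∈ A (J c x))
    (u : H) (e : ℕ → H) (c α β γ δ : ℕ → ℝ) (hc : ∀ k, 0 < c k)
    (x : ℕ → H)
    (hrec : ∀ k, x (k + 1) = α k • u + β k • x k + γ k • J (c k) (x k) + δ k • e k)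
    (ξ : ℕ → ℝ) (hξ : ∀ k, ξ k = |β k + γ k / 2| + |γ k / 2|)
    (hzer : ∃ p : H, (0 : H) ∈ A p)
    (hxbdd : Bornology.IsBounded (Set.range x))
    (hΩ : ∀ z : H, WSeqClusterPt x z → (0 : H) ∈ A z)
    (hξ1 : ∀ k, ξ k ≤ 1)
    (hξdiv : Tendsto (fun n => ∑ k ∈ Finset.range n, (1 - ξ k ^ 2)) atTop atTop)
    (hcase :
      -- (1)
      ((∀ k, 0 ≤ β k + γ k ∧ ξ k ^ 2 - β k - γ k ≤ 0) ∧
        Summable (fun k => |1 - α k - β k - γ k|) ∧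
        Summable (fun k => ‖δ k • e k‖)) ∨
      -- (2)
      ((∀ k, ξ k < 1) ∧
        BddAbove (Set.range fun k => (1 - β k - γ k) / (1 - ξ k ^ 2)) ∧
        Summable (fun k => |1 - α k - β k - γ k|) ∧
        Summable (fun k => ‖δ k • e k‖)) ∨
      -- (3)
      ((∀ k, 0 ≤ α k ∧ α k ≤ 1 ∧ α k + ξ k ^ 2 ≤ 1) ∧
        Summable (fun k => |1 - α k - β k - γ k|) ∧
        Summable (fun k => ‖δ k • e k‖)) ∨
      -- (4)
      ((∀ k, ξ k < 1 ∧ 0 ≤ α k) ∧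
        BddAbove (Set.range fun k => α k / (1 - ξ k ^ 2)) ∧
        Summable (fun k => |1 - α k - β k - γ k|) ∧
        Summable (fun k => ‖δ k • e k‖)) ∨
      -- (5)
      ((∀ k, 0 < α k ∧ α k ≤ 1 ∧ α k + ξ k ^ 2 ≤ 1) ∧
        Tendsto (fun k => (α k)⁻¹ • (δ k • e k)) atTop (nhds (0 : H)) ∧
        Tendsto (fun k => (1 - α k - β k - γ k) / α k) atTop (nhds 0)) ∨
      -- (6)
      ((∀ k, ξ k < 1 ∧ 0 < α k) ∧
        BddAbove (Set.range fun k => α k / (1 - ξ k ^ 2)) ∧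
        Tendsto (fun k => (α k)⁻¹ • (δ k • e k)) atTop (nhds (0 : H)) ∧
        Tendsto (fun k => (1 - α k - β k - γ k) / α k) atTop (nhds 0))) :
    ∃ p : H, (0 : H) ∈ A p ∧ (∀ z : H, (0 : H) ∈ A z → ⟪u - p, z - p⟫_ℝ ≤ 0) ∧
      Tendsto x atTop (nhds p) := by
  obtain ⟨p, hp, hproj⟩ := proj_aux A hmono hmax hzer u
  refine ⟨p, hp, hproj, ?_⟩
  obtain ⟨M, hM'⟩ := hxbdd.exists_norm_le
  have hM : ∀ k, ‖x k‖ ≤ M := fun k => hM' _ ⟨k, rfl⟩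
  have hξ0 : ∀ k, 0 ≤ ξ k := fun k => by rw [hξ k]; positivity
  have hcl : ∀ z, WSeqClusterPt x z → ⟪u - p, z - p⟫_ℝ ≤ 0 := fun z hz => hproj z (hΩ z hz)
  let v : ℕ → H := fun k => β k • (x k - p) + γ k • (J (c k) (x k) - p)
  have hv : ∀ k, ‖v k‖ ≤ ξ k * ‖x k - p‖ := by
    intro k
    rw [hξ k]
    refine step_aux _ _ _ _ _ ?_
    have h1 := hmono _ _ _ _ (hJ (c k) (hc k) (x k)) hp
    rw [sub_zero, real_inner_smul_right] at h1
    exact nonneg_of_mul_nonneg_right h1 (one_div_pos.2 (hc k))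
  have hbg : ∀ k, 0 ≤ 1 - β k - γ k := by
    intro k
    have h1 := hξ1 k
    rw [hξ k] at h1
    linarith [le_abs_self (β k + γ k / 2), le_abs_self (γ k / 2)]
  have hpos : (∀ k, ξ k < 1) → ∀ k, 0 < 1 - ξ k ^ 2 := fun h k => by nlinarith [h k, hξ0 k]
  have hbdd : ∀ a : ℕ → ℝ, (∀ k, ξ k < 1) →
      BddAbove (Set.range fun k => a k / (1 - ξ k ^ 2)) → ∃ C, ∀ k, a k ≤ C * (1 - ξ k ^ 2) := by
    rintro a h ⟨C, hC⟩
    refine ⟨C, fun k => ?_⟩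
    exact (div_le_iff₀ (hpos h k)).1 (hC ⟨k, rfl⟩)
  have core := core_aux x p u M hM ξ hξ0 hξ1 hξdiv hcl v
  -- form A
  have formA : ∀ C : ℝ, (∀ k, 1 - β k - γ k ≤ C * (1 - ξ k ^ 2)) →
      Summable (fun k => |1 - α k - β k - γ k|) → Summable (fun k => ‖δ k • e k‖) →
      Tendsto x atTop (nhds p) := by
    intro C hC h1 h2
    refine core (fun k => -(1 - α k - β k - γ k) • u + δ k • e k) (fun k => 1 - β k - γ k)
      (fun _ => 0) (fun k => |1 - α k - β k - γ k| * ‖u‖ + ‖δ k • e k‖) C hv ?_ hbg hC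
      (fun _ => le_rfl) tendsto_const_nhds (fun k => by positivity)
      ((h1.mul_right _).add h2) ?_
    · intro k
      rw [hrec k]
      simp only [v]
      module
    · intro k
      rw [mul_zero, zero_add]
      refine (norm_add_le _ _).trans ?_
      rw [norm_smul, norm_neg, Real.norm_eq_abs]
  have hxB : ∀ k, x (k + 1) - p
      = v k + α k • (u - p) + (-(1 - α k - β k - γ k) • p + δ k • e k) := by
    intro k
    rw [hrec k]
    simp only [v]
    module
  have hrB : ∀ k, ‖-(1 - α k - β k - γ k) • p + δ k • e k‖
      ≤ |1 - α k - β k - γ k| * ‖p‖ + ‖δ k • e k‖ := by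
    intro k
    refine (norm_add_le _ _).trans ?_
    rw [norm_smul, norm_neg, Real.norm_eq_abs]
  have formB : ∀ C : ℝ, (∀ k, 0 ≤ α k) → (∀ k, α k ≤ C * (1 - ξ k ^ 2)) →
      Summable (fun k => |1 - α k - β k - γ k|) → Summable (fun k => ‖δ k • e k‖) →
      Tendsto x atTop (nhds p) := by
    intro C h0 hC h1 h2
    refine core _ α (fun _ => 0) (fun k => |1 - α k - β k - γ k| * ‖p‖ + ‖δ k • e k‖) C hv hxB
      h0 hC (fun _ => le_rfl) tendsto_const_nhds (fun k => by positivity)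
      ((h1.mul_right _).add h2) ?_
    intro k
    rw [mul_zero, zero_add]
    exact hrB k
  have formC : ∀ C : ℝ, (∀ k, 0 < α k) → (∀ k, α k ≤ C * (1 - ξ k ^ 2)) →
      Tendsto (fun k => (α k)⁻¹ • (δ k • e k)) atTop (nhds (0 : H)) →
      Tendsto (fun k => (1 - α k - β k - γ k) / α k) atTop (nhds 0) →
      Tendsto x atTop (nhds p) := by
    intro C h0 hC h1 h2
    refine core _ α
      (fun k => |(1 - α k - β k - γ k) / α k| * ‖p‖ + ‖(α k)⁻¹ • (δ k • e k)‖)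
      (fun _ => 0) C hv hxB
      (fun k => (h0 k).le) hC (fun k => by positivity) ?_ (fun k => le_rfl)
      summable_zero ?_
    · have := (h2.abs.mul_const ‖p‖).add h1.norm
      simpa using this
    · intro k
      refine (hrB k).trans (le_of_eq ?_)
      have := h0 k
      rw [norm_smul (α k)⁻¹, Real.norm_eq_abs, abs_div, abs_inv, abs_of_pos this]
      field_simp
      ring
  rcases hcase with ⟨h, h1, h2⟩ | ⟨h, hb, h1, h2⟩ | ⟨h, h1, h2⟩ | ⟨h, hb, h1, h2⟩ |
    ⟨h, h1, h2⟩ | ⟨h, hb, h1, h2⟩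
  · exact formA 1 (fun k => by linarith [(h k).2]) h1 h2
  · obtain ⟨C, hC⟩ := hbdd _ h hb
    exact formA C hC h1 h2
  · exact formB 1 (fun k => (h k).1) (fun k => by linarith [(h k).2.2]) h1 h2
  · obtain ⟨C, hC⟩ := hbdd _ (fun k => (h k).1) hb
    exact formB C (fun k => (h k).2) hC h1 h2
  · exact formC 1 (fun k => (h k).1) (fun k => by linarith [(h k).2.2]) h1 h2
  · obtain ⟨C, hC⟩ := hbdd _ (fun k => (h k).1) hb
    exact formC C (fun k => (h k).2) hC h1 h2
end

section
/- Suppose that zer A ≠ ∅, that ∑_k (1 − ξ_k²) = ∞, and that one of the following holds: (1) for every k, |α_k| + ξ_k ≤ 1, β_k + γ_k ≥ 0 and ξ_k² − β_k − γ_k ≤ 0; ∑_k |1 − α_k − β_k − γ_k| < ∞ and ∑_k ‖δ_k e_k‖ < ∞; and α_k → 0, β_k → 0, γ_k → 1, and c_k → ∞; (2) for every k, |α_k| + ξ_k ≤ 1, β_k + γ_k ≥ 0 and ξ_k² − β_k − γ_k ≤ 0; ∑_k |1 − α_k − β_k − γ_k| < ∞ and ∑_k ‖δ_k e_k‖ <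 ∞; α_k → 0, limsup_{k→∞} |β_k| < 1, 0 < liminf_{k→∞} (1 − β_k − γ_k/2) ≤ limsup_{k→∞} (1 − β_k − γ_k/2) < 1, and 1 − c_k/c_{k+1} → 0; and inf_k c_k > 0 or c_k → ∞; (3) for every k, |α_k| + ξ_k ≤ 1, β_k + γ_k ≥ 0, ξ_k² − β_k − γ_k ≤ 0 and |γ_k| ∈ [0,1]; ∑_k |(α_{k+1} + γ_{k+1}) − (α_k + γ_k)| < ∞, ∑_k |1 − α_k − β_k − γ_k| < ∞, ∑_k |β_k| < ∞, ∑_k (1 − |γ_k|) = ∞, and ∑_k ‖δ_k e_k‖ < ∞; [∑_k |α_{k+1} − α_k| < ∞, or for every k, |γ_k| ≠ 1 and |α_{k+1} − α_k|/(1 − |γ_{k+1}|) → 0]; α_k → 0 and α_k + γ_k → 1; and inf_k c_k > 0 with ∑_k |c_{k+1} − c_k| < ∞; (4) for every k, α_k ∈ (0,1] and α_k + ξ_k ≤ 1; and α_k → 0, β_k → 0, γ_k → 1, δ_k e_k/α_k → 0, (1 − α_k − β_k − γ_k)/α_k → 0, and c_k → ∞. Then x_k converges strongly to P_{zer A} u.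 -/
open Filter InnerProductSpace

/-- A nonnegative sequence with `r (k+1) ≤ (1 - a k) r k + e k` eventually tends to zero. -/
theorem aux_L1 (r a e : ℕ → ℝ) (hr : ∀ k, 0 ≤ r k) (he : ∀ k, 0 ≤ e k) (hes : Summable e)
    (hdiv : Tendsto (fun n => ∑ k ∈ Finset.range n, a k) atTop atTop)
    (ha0 : ∀ k, 0 ≤ a k) (ha1 : ∀ k, a k ≤ 1)
    (hrec : ∀ᶠ k in atTop, r (k + 1) ≤ (1 - a k) * r k + e k) :
    Tendsto r atTop (nhds 0) := by
  rw [Metric.tendsto_atTop]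
  intro ε hε
  obtain ⟨N0, hN0⟩ := eventually_atTop.1 hrec
  have htail := tendsto_sum_nat_add e
  obtain ⟨N1, hN1⟩ := eventually_atTop.1 (htail.eventually (gt_mem_nhds (half_pos hε)))
  obtain ⟨N, hNN0, hNN1⟩ : ∃ N, N0 ≤ N ∧ N1 ≤ N := ⟨max N0 N1, le_max_left _ _, le_max_right _ _⟩
  have key : ∀ n, r (N + n) ≤ r N * Real.exp (-∑ i ∈ Finset.range n, a (N + i))
      + ∑ i ∈ Finset.range n, e (i + N) := by
    intro n
    induction n with
    | zero => simp
    | succ n ih =>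
      have h1 := hN0 (N + n) (by omega)
      have h2 : (1 - a (N + n)) ≤ Real.exp (-a (N + n)) := by
        have := Real.add_one_le_exp (-a (N + n)); linarith
      have h3 : 0 ≤ 1 - a (N + n) := by linarith [ha1 (N + n)]
      rw [Finset.sum_range_succ, Finset.sum_range_succ, neg_add, Real.exp_add]
      have hs : 0 ≤ ∑ i ∈ Finset.range n, e (i + N) := Finset.sum_nonneg fun i _ => he _
      have h0 := ha0 (N + n)
      have e1 : (1 - a (N + n)) * r (N + n) ≤ (1 - a (N + n)) * (r N * Real.exp (-∑ i ∈ Finset.range n, a (N + i))) + ∑ i ∈ Finset.range n, e (i + N) := by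
          have := mul_le_mul_of_nonneg_left ih h3
          nlinarith
      have e2 : (1 - a (N + n)) * (r N * Real.exp (-∑ i ∈ Finset.range n, a (N + i))) ≤ Real.exp (-a (N + n)) * (r N * Real.exp (-∑ i ∈ Finset.range n, a (N + i))) :=
          mul_le_mul_of_nonneg_right h2 (mul_nonneg (hr _) (Real.exp_pos _).le)
      rw [← add_assoc, add_comm n N]
      linarith
  have hexp : Tendsto (fun n => r N * Real.exp (-∑ i ∈ Finset.range n, a (N + i))) atTop (nhds 0) := by
    have h1 : Tendsto (fun n => ∑ i ∈ Finset.range n, a (N + i)) atTop atTop := by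
      have h2 : Tendsto (fun n => ∑ k ∈ Finset.range (N + n), a k) atTop atTop :=
        hdiv.comp (tendsto_atTop_mono (fun n => Nat.le_add_left n N) tendsto_id)
      have h3 := tendsto_atTop_add_const_right atTop (-∑ k ∈ Finset.range N, a k) h2
      refine h3.congr fun n => ?_
      rw [Finset.sum_range_add]; ring
    have h4 := (Real.tendsto_exp_neg_atTop_nhds_zero.comp h1).const_mul (r N)
    simpa using h4
  obtain ⟨M, hM⟩ := eventually_atTop.1 (hexp.eventually (gt_mem_nhds (half_pos hε)))
  refine ⟨N + M, fun n hn => ?_⟩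
  obtain ⟨m, rfl⟩ := Nat.exists_eq_add_of_le (show N ≤ n by omega)
  have h1 := key m
  have h2 := hM m (by omega)
  have h3 := hN1 N hNN1
  have h4 : ∑ i ∈ Finset.range m, e (i + N) ≤ ∑' i, e (i + N) :=
    ((summable_nat_add_iff N).2 hes).sum_le_tsum _ (fun i _ => he _)
  rw [Real.dist_eq, sub_zero, abs_of_nonneg (hr _)]
  linarith

theorem aux_L2 (s w b e g θ : ℕ → ℝ) (S κ : ℝ) (hκ : 0 < κ) (hs : ∀ k, 0 ≤ s k) (hS : ∀ k, s k ≤ S)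
    (hw0 : ∀ k, 0 ≤ w k) (hw1 : ∀ k, w k ≤ 1)
    (hdiv : Tendsto (fun n => ∑ k ∈ Finset.range n, w k) atTop atTop)
    (he : ∀ k, 0 ≤ e k) (hes : Summable e)
    (h1 : ∀ k, s (k + 1) ≤ (1 - w k) * s k + w k * b k + e k)
    (h2 : ∀ᶠ k in atTop, s (k + 1) ≤ s k - κ * g k + θ k)
    (hθ : Tendsto θ atTop (nhds 0))
    (h3 : ∀ ε > 0, ∃ ρ > 0, ∀ᶠ k in atTop, g k ≤ ρ → b k ≤ ε) :
    Tendsto s atTop (nhds 0) := by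
  have key : ∀ ε > 0, Tendsto (fun k => max (s k - ε) 0) atTop (nhds 0) := by
    intro ε hε
    obtain ⟨ρ, hρ, hgb⟩ := h3 ε hε
    have hS0 : 0 ≤ S := (hs 0).trans (hS 0)
    have hκρ : 0 < κ * ρ / 2 := by positivity
    obtain ⟨t, ht0, ht1, htS⟩ : ∃ t : ℝ, 0 < t ∧ t ≤ 1 ∧ t * S ≤ κ * ρ / 2 := by
      refine ⟨min 1 (κ * ρ / 2 / (S + 1)), by positivity, min_le_left _ _, ?_⟩
      have hh : κ * ρ / 2 / (S + 1) * (S + 1) = κ * ρ / 2 := by field_simp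
      have h5 : min 1 (κ * ρ / 2 / (S + 1)) * S ≤ κ * ρ / 2 / (S + 1) * S :=
        mul_le_mul_of_nonneg_right (min_le_right _ _) hS0
      have : 0 < κ * ρ / 2 / (S + 1) := by positivity
      nlinarith
    refine aux_L1 _ (fun k => t * w k) e (fun k => le_max_right _ _) he hes ?_
      (fun k => mul_nonneg ht0.le (hw0 k)) (fun k => ?_) ?_
    · have := hdiv.const_mul_atTop ht0
      simpa [Finset.mul_sum] using this
    · have := hw0 k; have := hw1 k; nlinarith
    · filter_upwards [hgb, h2, hθ.eventually (gt_mem_nhds hκρ)] with k hk1 hk2 hk3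
      have hm0 : 0 ≤ max (s k - ε) 0 := le_max_right _ _
      have hm1 : s k - ε ≤ max (s k - ε) 0 := le_max_left _ _
      have hmS : max (s k - ε) 0 ≤ S := max_le (by linarith [hS k]) hS0
      have hwk0 := hw0 k
      have hwk1 := hw1 k
      have htw : t * w k ≤ w k := by nlinarith
      have hek := he k
      have hnn : 0 ≤ (1 - t * w k) * max (s k - ε) 0 := mul_nonneg (by linarith) hm0
      refine max_le ?_ (by linarith)
      by_cases hg : g k ≤ ρ
      · have hb := mul_le_mul_of_nonneg_left (hk1 hg) hwk0
        have := h1 k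
        have e1 : (1 - w k) * (s k - ε) ≤ (1 - w k) * max (s k - ε) 0 :=
          mul_le_mul_of_nonneg_left hm1 (by linarith)
        have e2 : (1 - w k) * max (s k - ε) 0 ≤ (1 - t * w k) * max (s k - ε) 0 :=
          mul_le_mul_of_nonneg_right (by linarith) hm0
        linarith
      · have e1 : κ * ρ ≤ κ * g k := mul_le_mul_of_nonneg_left (not_le.1 hg).le hκ.le
        have e2 : t * w k * max (s k - ε) 0 ≤ t * S := by
          have : t * w k ≤ t := by nlinarith
          exact mul_le_mul this hmS hm0 ht0.le
        linarith
  rw [Metric.tendsto_atTop]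
  intro ε hε
  obtain ⟨N, hN⟩ := eventually_atTop.1 ((key (ε / 2) (half_pos hε)).eventually (gt_mem_nhds (half_pos hε)))
  refine ⟨N, fun n hn => ?_⟩
  rw [Real.dist_eq, sub_zero, abs_of_nonneg (hs n)]
  have := hN n hn
  have := le_max_left (s n - ε / 2) 0
  linarith

section
variable {H : Type*} [NormedAddCommGroup H] [InnerProductSpace ℝ H]

/-- The resolvent curve `J_t u` converges to the projection. -/
theorem aux_proj [CompleteSpace H]
    (A : H → Set H)
    (hmono : ∀ x y xu yv : H, xu ∈ A x → yv ∈ A y → 0 ≤ ⟪x - y, xu - yv⟫_ℝ)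
    (hmax : ∀ x xu : H, (∀ y yv : H, yv ∈ A y → 0 ≤ ⟪x - y, xu - yv⟫_ℝ) → xu ∈ A x)
    (J : ℝ → H → H)
    (hJ : ∀ c : ℝ, 0 < c → ∀ x : H, (1 / c) • (x - J c x) ∈ A (J c x))
    (u : H) (hzer : ∃ p : H, (0 : H) ∈ A p) :
    ∃ p : H, (0 : H) ∈ A p ∧ (∀ z : H, (0 : H) ∈ A z → ⟪u - p, z - p⟫_ℝ ≤ 0) ∧
      Tendsto (fun n : ℕ => J ((n : ℝ) + 1) u) atTop (nhds p) := by
  have hpos : ∀ n : ℕ, (0 : ℝ) < (n : ℝ) + 1 := fun n => by positivity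
  set D : ℕ → H := fun n => u - J ((n : ℝ) + 1) u with hD
  have hzeq : ∀ n : ℕ, J ((n : ℝ) + 1) u = u - D n := fun n => by simp [hD]
  have hmem : ∀ n : ℕ, (1 / ((n : ℝ) + 1)) • D n ∈ A (u - D n) := fun n => by
    have := hJ _ (hpos n) u
    rw [← hzeq]; exact this
  have hvar : ∀ n z, (0 : H) ∈ A z → 0 ≤ ⟪u - D n - z, D n⟫_ℝ := by
    intro n z hz
    have h := hmono _ _ _ _ (hmem n) hz
    rw [sub_zero, inner_smul_right] at h
    exact nonneg_of_mul_nonneg_right h (by have := hpos n; positivity)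
  obtain ⟨z0, hz0⟩ := hzer
  have hbd : ∀ n, ‖D n‖ ≤ ‖u - z0‖ := by
    intro n
    have h := hvar n z0 hz0
    have e1 : ⟪u - D n - z0, D n⟫_ℝ = ⟪u - z0, D n⟫_ℝ - ‖D n‖ ^ 2 := by
      rw [← real_inner_self_eq_norm_sq, ← inner_sub_left]; congr 1; abel
    have e2 := real_inner_le_norm (u - z0) (D n)
    by_contra hcon
    push Not at hcon
    have := norm_nonneg (u - z0)
    nlinarith
  have hdiff : ∀ m n, m ≤ n → ‖D n - D m‖ ^ 2 ≤ ‖D n‖ ^ 2 - ‖D m‖ ^ 2 := by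
    intro m n hmn
    rcases hmn.eq_or_lt with rfl | hlt
    · simp
    have h := hmono _ _ _ _ (hmem m) (hmem n)
    have hab : 1 / ((n : ℝ) + 1) < 1 / ((m : ℝ) + 1) := by
      apply one_div_lt_one_div_of_lt (hpos m)
      have : (m : ℝ) < n := by exact_mod_cast hlt
      linarith
    have hb : 0 < 1 / ((n : ℝ) + 1) := by have := hpos n; positivity
    set a := 1 / ((m : ℝ) + 1)
    set b := 1 / ((n : ℝ) + 1)
    have e1 : ⟪u - D m - (u - D n), a • D m - b • D n⟫_ℝ
        = (a + b) * ⟪D n, D m⟫_ℝ - a * ‖D m‖ ^ 2 - b * ‖D n‖ ^ 2 := by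
      rw [show u - D m - (u - D n) = D n - D m by abel]
      simp only [inner_sub_left, inner_sub_right, inner_smul_right, real_inner_self_eq_norm_sq]
      rw [real_inner_comm (D n) (D m)]; ring
    have e2 := norm_sub_sq_real (D n) (D m)
    rw [e1] at h
    have h6 : (a + b) * ‖D n - D m‖ ^ 2 ≤ (a - b) * (‖D n‖ ^ 2 - ‖D m‖ ^ 2) := by
      rw [e2]; nlinarith
    have h7 : 0 ≤ ‖D n‖ ^ 2 - ‖D m‖ ^ 2 := by
      by_contra hcon
      push Not at hcon
      have : 0 ≤ (a + b) * ‖D n - D m‖ ^ 2 := mul_nonneg (by linarith) (sq_nonneg _)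
      nlinarith
    have h8 : (a + b) * ‖D n - D m‖ ^ 2 ≤ (a + b) * (‖D n‖ ^ 2 - ‖D m‖ ^ 2) := by nlinarith
    exact le_of_mul_le_mul_left h8 (by linarith)
  have hmonoD : Monotone (fun n => ‖D n‖ ^ 2) := fun m n hmn => by
    have := hdiff m n hmn
    have := sq_nonneg ‖D n - D m‖
    show ‖D m‖ ^ 2 ≤ ‖D n‖ ^ 2
    linarith
  have hbdd : BddAbove (Set.range (fun n => ‖D n‖ ^ 2)) := by
    refine ⟨‖u - z0‖ ^ 2, ?_⟩
    rintro _ ⟨n, rfl⟩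
    exact pow_le_pow_left₀ (norm_nonneg _) (hbd n) 2
  have hcv := tendsto_atTop_ciSup hmonoD hbdd
  have hcau : CauchySeq D := by
    have hc2 := hcv.cauchySeq
    rw [Metric.cauchySeq_iff'] at hc2 ⊢
    intro ε hε
    obtain ⟨N, hN⟩ := hc2 (ε ^ 2) (by positivity)
    refine ⟨N, fun n hn => ?_⟩
    have h1 := hN n hn
    rw [Real.dist_eq] at h1
    rw [dist_eq_norm]
    have h2 := hdiff N n hn
    have h3 := le_abs_self (‖D n‖ ^ 2 - ‖D N‖ ^ 2)
    exact lt_of_pow_lt_pow_left₀ 2 hε.le (by linarith)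
  obtain ⟨d, hd⟩ := cauchySeq_tendsto_of_complete hcau
  have hinv : Tendsto (fun n : ℕ => 1 / ((n : ℝ) + 1)) atTop (nhds 0) :=
    tendsto_one_div_add_atTop_nhds_zero_nat
  refine ⟨u - d, ?_, ?_, ?_⟩
  · apply hmax
    intro y v hv
    have hl : Tendsto (fun n : ℕ => ⟪u - D n - y, (1 / ((n : ℝ) + 1)) • D n - v⟫_ℝ) atTop
        (nhds ⟪u - d - y, (0 : ℝ) • d - v⟫_ℝ) :=
      (((tendsto_const_nhds.sub hd).sub tendsto_const_nhds)).inner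
        ((hinv.smul hd).sub tendsto_const_nhds)
    rw [zero_smul] at hl
    exact ge_of_tendsto' hl fun n => hmono _ _ _ _ (hmem n) hv
  · intro z hz
    have hl : Tendsto (fun n : ℕ => ⟪u - D n - z, D n⟫_ℝ) atTop (nhds ⟪u - d - z, d⟫_ℝ) :=
      (((tendsto_const_nhds.sub hd).sub tendsto_const_nhds)).inner hd
    have h := ge_of_tendsto' hl fun n => hvar n z hz
    rw [show u - (u - d) = d by abel, real_inner_comm,
      show z - (u - d) = -(u - d - z) by abel, inner_neg_left]
    linarith
  · simp_rw [hzeq]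
    exact tendsto_const_nhds.sub hd

/-- Quantitative demiclosedness. -/
theorem aux_demi
    (A : H → Set H)
    (hmono : ∀ x y xu yv : H, xu ∈ A x → yv ∈ A y → 0 ≤ ⟪x - y, xu - yv⟫_ℝ)
    (J : ℝ → H → H)
    (hJ : ∀ c : ℝ, 0 < c → ∀ x : H, (1 / c) • (x - J c x) ∈ A (J c x))
    (u p : H) (hp : Tendsto (fun n : ℕ => J ((n : ℝ) + 1) u) atTop (nhds p))
    (M ε : ℝ) (hM : 0 ≤ M) (hε : 0 < ε) :
    ∃ ρ > 0, ∀ y v : H, v ∈ A y → ‖y - p‖ ≤ M → ‖v‖ ≤ ρ → ⟪u - p, y - p⟫_ℝ ≤ ε := by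
  have hp' : Tendsto (fun n : ℕ => ‖J ((n : ℝ) + 1) u - p‖) atTop (nhds 0) := by
    rw [tendsto_iff_norm_sub_tendsto_zero] at hp; exact hp
  set U := ‖u - p‖ with hU
  have hU0 : 0 ≤ U := norm_nonneg _
  obtain ⟨σ, hσ, hσ1, hσ2⟩ : ∃ σ : ℝ, 0 < σ ∧ σ ≤ 1 ∧ σ * (U + M + 1) ≤ ε / 2 := by
    refine ⟨min 1 (ε / 2 / (U + M + 1)), by positivity, min_le_left _ _, ?_⟩
    rw [← le_div_iff₀ (by positivity)]
    exact min_le_right _ _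
  obtain ⟨n, hn⟩ := (hp'.eventually (gt_mem_nhds hσ)).exists
  set t : ℝ := (n : ℝ) + 1 with ht
  have ht0 : 0 < t := by positivity
  set z := J t u with hz
  refine ⟨ε / 2 / (t * (M + 1)), by positivity, ?_⟩
  intro y v hv hy hvρ
  have h := hmono _ _ _ _ hv (hJ t ht0 u)
  rw [← hz, inner_sub_right, inner_smul_right] at h
  have h1 : ⟪y - z, u - z⟫_ℝ ≤ t * ⟪y - z, v⟫_ℝ := by
    have : ⟪y - z, u - z⟫_ℝ = t * (1 / t * ⟪y - z, u - z⟫_ℝ) := by field_simp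
    rw [this]
    exact mul_le_mul_of_nonneg_left (by linarith) ht0.le
  have h2 : ‖y - z‖ ≤ M + 1 := by
    calc ‖y - z‖ = ‖(y - p) - (z - p)‖ := by congr 1; abel
      _ ≤ ‖y - p‖ + ‖z - p‖ := norm_sub_le _ _
      _ ≤ M + 1 := by linarith
  have h3 : t * ⟪y - z, v⟫_ℝ ≤ ε / 2 := by
    have e1 : ⟪y - z, v⟫_ℝ ≤ (M + 1) * (ε / 2 / (t * (M + 1))) :=
      (real_inner_le_norm _ _).trans (mul_le_mul h2 hvρ (norm_nonneg _) (by linarith))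
    have e2 : t * ((M + 1) * (ε / 2 / (t * (M + 1)))) = ε / 2 := by field_simp
    rw [← e2]
    exact mul_le_mul_of_nonneg_left e1 ht0.le
  have e3 : ⟪u - p, y - p⟫_ℝ = ⟪y - z, u - z⟫_ℝ + ⟪y - z, z - p⟫_ℝ + ⟪u - p, z - p⟫_ℝ := by
    rw [← inner_add_right, show u - z + (z - p) = u - p by abel, real_inner_comm, real_inner_comm (z - p),
      ← inner_add_left, show y - z + (z - p) = y - p by abel]
  have h4 : ⟪y - z, z - p⟫_ℝ ≤ (M + 1) * σ :=
    (real_inner_le_norm _ _).trans (mul_le_mul h2 hn.le (norm_nonneg _) (by linarith))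
  have h5 : ⟪u - p, z - p⟫_ℝ ≤ U * σ :=
    (real_inner_le_norm _ _).trans (mul_le_mul le_rfl hn.le (norm_nonneg _) hU0)
  rw [e3]
  linarith

end

section
variable {H : Type*} [NormedAddCommGroup H] [InnerProductSpace ℝ H]

/-- `‖2Y - X‖ ≤ ‖X‖` for a firmly nonexpansive step. -/
theorem aux_refl (X Y : H) (h : 0 ≤ ⟪Y, X - Y⟫_ℝ) : ‖(2 : ℝ) • Y - X‖ ≤ ‖X‖ := by
  refine le_of_sq_le_sq ?_ (norm_nonneg _)
  rw [norm_sub_sq_real, norm_smul, inner_smul_left, mul_pow]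
  rw [inner_sub_right, real_inner_self_eq_norm_sq] at h
  simp
  nlinarith

theorem aux_comb (X Y : H) (l : ℝ) :
    ‖(1 - l) • X + l • Y‖ ^ 2 = (1 - l) * ‖X‖ ^ 2 + l * ‖Y‖ ^ 2 - l * (1 - l) * ‖X - Y‖ ^ 2 := by
  rw [norm_add_sq_real, norm_sub_sq_real, norm_smul, norm_smul, inner_smul_left, inner_smul_right,
    mul_pow, mul_pow]
  simp only [Real.norm_eq_abs, sq_abs, conj_trivial]
  ring

theorem aux_sq (a b : H) : ‖a + b‖ ^ 2 ≤ ‖a‖ ^ 2 + 2 * ⟪b, a + b⟫_ℝ := by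
  have h := norm_sub_sq_real (a + b) b
  rw [add_sub_cancel_right] at h
  rw [real_inner_comm]
  rw [h, inner_add_left, real_inner_self_eq_norm_sq, norm_add_sq_real]
  have := sq_nonneg ‖b‖
  linarith

theorem aux_core
    (A : H → Set H)
    (hmono : ∀ x y xu yv : H, xu ∈ A x → yv ∈ A y → 0 ≤ ⟪x - y, xu - yv⟫_ℝ)
    (J : ℝ → H → H)
    (hJ : ∀ c : ℝ, 0 < c → ∀ x : H, (1 / c) • (x - J c x) ∈ A (J c x))
    (u p : H) (e : ℕ → H) (c α β γ δ : ℕ → ℝ) (hc : ∀ k, 0 < c k)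
    (x : ℕ → H)
    (hrec : ∀ k, x (k + 1) = α k • u + β k • x k + γ k • J (c k) (x k) + δ k • e k)
    (ξ : ℕ → ℝ) (hξ : ∀ k, ξ k = |β k + γ k / 2| + |γ k / 2|)
    (hpA : (0 : H) ∈ A p)
    (hp : Tendsto (fun n : ℕ => J ((n : ℝ) + 1) u) atTop (nhds p))
    (hξdiv : Tendsto (fun n => ∑ k ∈ Finset.range n, (1 - ξ k ^ 2)) atTop atTop)
    (ε o : ℕ → ℝ) (hε0 : ∀ k, 0 ≤ ε k) (hεs : Summable ε)
    (ho0 : ∀ k, 0 ≤ o k) (ho : Tendsto o atTop (nhds 0))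
    (h1 : ∀ k, |α k| + ξ k ≤ 1)
    (h2 : ∀ k, α k ≤ (1 - ξ k ^ 2) + ε k) (h2' : ∀ k, -ε k ≤ α k)
    (h3 : ∀ k, ‖δ k • e k‖ + |1 - α k - β k - γ k| * ‖p‖ ≤ |α k| * o k + ε k)
    (hα : Tendsto α atTop (nhds 0))
    (hη : Tendsto (fun k => 1 - α k - β k - γ k) atTop (nhds 0))
    (κ : ℝ) (hκ : 0 < κ)
    (hlam : ∀ᶠ k in atTop, κ ≤ (1 - β k - γ k / 2) * (1 - (1 - β k - γ k / 2)))
    (c0 : ℝ) (hc0 : 0 < c0) (hcc : ∀ᶠ k in atTop, c0 ≤ c k) :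
    Tendsto x atTop (nhds p) := by
  set y : ℕ → H := fun k => J (c k) (x k) with hy
  set X : ℕ → H := fun k => x k - p with hX
  set Y : ℕ → H := fun k => y k - p with hY
  set η : ℕ → ℝ := fun k => 1 - α k - β k - γ k with hηd
  set l : ℕ → ℝ := fun k => 1 - β k - γ k / 2 with hl
  set w : ℕ → ℝ := fun k => 1 - ξ k ^ 2 with hw
  set R : ℕ → H := fun k => (2 : ℝ) • Y k - X k with hR
  set er : ℕ → H := fun k => δ k • e k - η k • p with her
  set U := ‖u - p‖ with hU
  have hU0 : 0 ≤ U := norm_nonneg _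
  have hξ0 : ∀ k, 0 ≤ ξ k := fun k => by rw [hξ]; positivity
  have hξ1 : ∀ k, ξ k ≤ 1 := fun k => by have := h1 k; have := abs_nonneg (α k); linarith
  have hw0 : ∀ k, 0 ≤ w k := fun k => by
    have := hξ0 k; have := hξ1 k; show 0 ≤ 1 - ξ k ^ 2; nlinarith
  have hw1 : ∀ k, w k ≤ 1 := fun k => by
    have := sq_nonneg (ξ k); show 1 - ξ k ^ 2 ≤ 1; linarith
  have hJk : ∀ k, (1 / c k) • (x k - y k) ∈ A (y k) := fun k => hJ _ (hc k) _
  have hRX : ∀ k, ‖R k‖ ≤ ‖X k‖ := by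
    intro k
    apply aux_refl
    have h := hmono _ _ _ _ (hJk k) hpA
    rw [sub_zero, inner_smul_right] at h
    have h' := nonneg_of_mul_nonneg_right h (by have := hc k; positivity)
    have : X k - Y k = x k - y k := by simp [hX, hY]
    rw [this]; exact h'
  have hq : ∀ k, ‖β k • X k + γ k • Y k‖ ≤ ξ k * ‖X k‖ := by
    intro k
    have e1 : β k • X k + γ k • Y k = (β k + γ k / 2) • X k + (γ k / 2) • R k := by
      simp only [hR]; module
    rw [e1, hξ, add_mul]
    refine (norm_add_le _ _).trans ?_
    rw [norm_smul, norm_smul, Real.norm_eq_abs, Real.norm_eq_abs]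
    have := mul_le_mul_of_nonneg_left (hRX k) (abs_nonneg (γ k / 2))
    linarith
  have hstep : ∀ k, X (k + 1) = (β k • X k + γ k • Y k) + (α k • (u - p) + er k) := by
    intro k
    simp only [hX, hY, her, hηd]
    rw [hrec]
    module
  have herr : ∀ k, ‖er k‖ ≤ |α k| * o k + ε k := by
    intro k
    refine le_trans ?_ (h3 k)
    refine (norm_sub_le _ _).trans ?_
    rw [norm_smul (η k), Real.norm_eq_abs]
  -- boundedness
  obtain ⟨O, hO⟩ := ho.bddAbove_range
  have hO' : ∀ k, o k ≤ O := fun k => hO ⟨k, rfl⟩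
  have hO0 : 0 ≤ O := (ho0 0).trans (hO' 0)
  obtain ⟨M, hM⟩ : ∃ M, ∀ k, ‖X k‖ ≤ M := by
    refine ⟨max (U + O) ‖X 0‖ + ∑' i, ε i, ?_⟩
    have key : ∀ k, ‖X k‖ ≤ max (U + O) ‖X 0‖ + ∑ i ∈ Finset.range k, ε i := by
      intro k
      induction k with
      | zero => simp
      | succ k ih =>
        rw [Finset.sum_range_succ, hstep]
        have hs : 0 ≤ ∑ i ∈ Finset.range k, ε i := Finset.sum_nonneg fun i _ => hε0 i
        have a1 := norm_add_le (β k • X k + γ k • Y k) (α k • (u - p) + er k)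
        have a2 := norm_add_le (α k • (u - p)) (er k)
        rw [norm_smul, Real.norm_eq_abs] at a2
        have a3 := hq k
        have a4 := herr k
        have a5 : |α k| * o k ≤ |α k| * O := mul_le_mul_of_nonneg_left (hO' k) (abs_nonneg _)
        set m := max (U + O) ‖X 0‖
        have a6 : |α k| * (U + O) ≤ |α k| * (m + ∑ i ∈ Finset.range k, ε i) :=
          mul_le_mul_of_nonneg_left ((le_max_left _ _).trans (le_add_of_nonneg_right hs))
            (abs_nonneg _)
        have a7 := mul_le_mul_of_nonneg_left ih (hξ0 k)
        have a8 : 0 ≤ m + ∑ i ∈ Finset.range k, ε i := (norm_nonneg _).trans ih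
        have a9 := mul_le_mul_of_nonneg_right (h1 k) a8
        linarith
    intro k
    have := hεs.sum_le_tsum (Finset.range k) (fun i _ => hε0 i)
    linarith [key k]
  have hM0 : 0 ≤ M := (norm_nonneg _).trans (hM 0)
  -- limits
  have hεt : Tendsto ε atTop (nhds 0) := hεs.tendsto_atTop_zero
  have hαa : Tendsto (fun k => |α k|) atTop (nhds 0) := by simpa using hα.abs
  have hηa : Tendsto (fun k => |η k|) atTop (nhds 0) := by simpa using hη.abs
  -- second representation
  set h : ℕ → H := fun k => α k • (u - p) - (α k + η k) • R k + er k with hh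
  have hstep2 : ∀ k, X (k + 1) = ((1 - l k) • X k + l k • R k) + h k := by
    intro k
    rw [hstep]
    simp only [hh, hR, hl, hηd]
    module
  set hb : ℕ → ℝ := fun k => |α k| * U + (|α k| + |η k|) * M + (|α k| * o k + ε k) with hhb
  have hhn : ∀ k, ‖h k‖ ≤ hb k := by
    intro k
    refine (norm_add_le _ _).trans (add_le_add ((norm_sub_le _ _).trans (add_le_add ?_ ?_)) (herr k))
    · rw [norm_smul, Real.norm_eq_abs]
    · rw [norm_smul, Real.norm_eq_abs]
      exact mul_le_mul (abs_add_le _ _) ((hRX k).trans (hM k)) (norm_nonneg _) (by positivity)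
  have hbt : Tendsto hb atTop (nhds 0) := by
    have := ((hαa.mul_const U).add ((hαa.add hηa).mul_const M)).add ((hαa.mul ho).add hεt)
    simpa using this
  have hl01 : ∀ᶠ k in atTop, 0 ≤ l k ∧ l k ≤ 1 := by
    filter_upwards [hlam] with k hk
    change κ ≤ l k * (1 - l k) at hk
    constructor <;> nlinarith
  -- the convergence of squares
  have hs : Tendsto (fun k => ‖X k‖ ^ 2) atTop (nhds 0) := by
    refine aux_L2 (fun k => ‖X k‖ ^ 2) w
      (fun k => 2 * max ⟪u - p, X (k + 1)⟫_ℝ 0 + 2 * o k * M)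
      (fun k => ε k * (2 * (U * M) + 2 * O * M + 2 * M))
      (fun k => ‖x k - y k‖ ^ 2) (fun k => 2 * hb k * M) (M ^ 2) (4 * κ) (by positivity)
      (fun k => by positivity) (fun k => pow_le_pow_left₀ (norm_nonneg _) (hM k) 2) hw0 hw1 hξdiv
      (fun k => mul_nonneg (hε0 k) (by positivity)) (hεs.mul_right _) ?_ ?_ ?_ ?_
    · intro k
      show ‖X (k + 1)‖ ^ 2 ≤ (1 - w k) * ‖X k‖ ^ 2 +
        w k * (2 * max ⟪u - p, X (k + 1)⟫_ℝ 0 + 2 * o k * M) +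
        ε k * (2 * (U * M) + 2 * O * M + 2 * M)
      have b1 := aux_sq (β k • X k + γ k • Y k) (α k • (u - p) + er k)
      rw [← hstep, inner_add_left, inner_smul_left] at b1
      simp only [conj_trivial] at b1
      have b2 : ‖β k • X k + γ k • Y k‖ ^ 2 ≤ (1 - w k) * ‖X k‖ ^ 2 := by
        have := pow_le_pow_left₀ (norm_nonneg _) (hq k) 2
        rw [mul_pow] at this
        simpa [hw] using this
      have b3 : ⟪er k, X (k + 1)⟫_ℝ ≤ (|α k| * o k + ε k) * M :=
        (real_inner_le_norm _ _).trans
          (mul_le_mul (herr k) (hM _) (norm_nonneg _) ((norm_nonneg _).trans (herr k)))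
      have habs : |⟪u - p, X (k + 1)⟫_ℝ| ≤ U * M :=
        (abs_real_inner_le_norm _ _).trans (mul_le_mul le_rfl (hM _) (norm_nonneg _) hU0)
      have hA2 : α k ≤ w k + ε k := h2 k
      have b4 : α k * ⟪u - p, X (k + 1)⟫_ℝ ≤
          w k * max ⟪u - p, X (k + 1)⟫_ℝ 0 + ε k * (U * M) := by
        set b := ⟪u - p, X (k + 1)⟫_ℝ
        obtain ⟨hb1, hb2⟩ := abs_le.1 habs
        have := hε0 k
        have := h2' k
        have := hw0 k
        rcases le_total 0 b with hb0 | hb0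
        · rw [max_eq_left hb0]; nlinarith
        · rw [max_eq_right hb0]; nlinarith
      have b5 : |α k| ≤ w k + ε k := abs_le.2 ⟨by linarith [h2' k, hw0 k], hA2⟩
      have b6 : |α k| * o k * M ≤ w k * (o k * M) + ε k * (O * M) := by
        have c1 : |α k| * (o k * M) ≤ (w k + ε k) * (o k * M) :=
          mul_le_mul_of_nonneg_right b5 (mul_nonneg (ho0 k) hM0)
        have c2 : ε k * (o k * M) ≤ ε k * (O * M) :=
          mul_le_mul_of_nonneg_left (mul_le_mul_of_nonneg_right (hO' k) hM0) (hε0 k)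
        linarith
      linarith
    · filter_upwards [hlam, hl01] with k hk hk2
      change κ ≤ l k * (1 - l k) at hk
      show ‖X (k + 1)‖ ^ 2 ≤ ‖X k‖ ^ 2 - 4 * κ * ‖x k - y k‖ ^ 2 + 2 * hb k * M
      have b1 := aux_sq ((1 - l k) • X k + l k • R k) (h k)
      rw [← hstep2, aux_comb] at b1
      have b2 : ⟪h k, X (k + 1)⟫_ℝ ≤ hb k * M :=
        (real_inner_le_norm _ _).trans
          (mul_le_mul (hhn k) (hM _) (norm_nonneg _) ((norm_nonneg _).trans (hhn k)))
      have b3 : ‖R k‖ ^ 2 ≤ ‖X k‖ ^ 2 := pow_le_pow_left₀ (norm_nonneg _) (hRX k) 2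
      have b4 : ‖X k - R k‖ ^ 2 = 4 * ‖x k - y k‖ ^ 2 := by
        have : X k - R k = (2 : ℝ) • (x k - y k) := by simp only [hR, hX, hY]; module
        rw [this, norm_smul, mul_pow]; norm_num
      rw [b4] at b1
      have b5 := mul_le_mul_of_nonneg_left b3 hk2.1
      have b6 := mul_le_mul_of_nonneg_right hk (sq_nonneg ‖x k - y k‖)
      linarith
    · have := (hbt.const_mul 2).mul_const M
      simpa using this
    · intro ε' hε'
      obtain ⟨ρ, hρ, hdem⟩ := aux_demi A hmono J hJ u p hp M (ε' / 8) hM0 (by positivity)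
      set r := min (ρ * c0) (ε' / (8 * (U + 1))) with hr
      have hr0 : 0 < r := by positivity
      refine ⟨r ^ 2, by positivity, ?_⟩
      have t1 : ∀ᶠ k in atTop, hb k * U < ε' / 8 := by
        have := hbt.mul_const U
        rw [zero_mul] at this
        exact this.eventually (gt_mem_nhds (by positivity))
      have t2 : ∀ᶠ k in atTop, o k * M < ε' / 8 := by
        have := ho.mul_const M
        rw [zero_mul] at this
        exact this.eventually (gt_mem_nhds (by positivity))
      filter_upwards [t1, t2, hcc, hl01] with k k1 k2 k3 k4 hg
      have hg' : ‖x k - y k‖ ≤ r := le_of_sq_le_sq hg hr0.le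
      have hYn : ‖Y k‖ ≤ M := by
        have e1 : Y k = (1 / 2 : ℝ) • (R k + X k) := by simp only [hR]; module
        rw [e1, norm_smul]
        have := norm_add_le (R k) (X k)
        have := hRX k
        have := hM k
        norm_num
        linarith
      have d1 : ⟪u - p, Y k⟫_ℝ ≤ ε' / 8 := by
        refine hdem (y k) _ (hJk k) hYn ?_
        have hck := hc k
        rw [norm_smul, Real.norm_eq_abs, abs_of_pos (by positivity), one_div, inv_mul_le_iff₀ hck]
        have : ρ * c0 ≤ ρ * c k := mul_le_mul_of_nonneg_left k3 hρ.le
        have : r ≤ ρ * c0 := min_le_left _ _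
        linarith
      have d2 : X (k + 1) = Y k + ((1 - 2 * l k) • (x k - y k) + h k) := by
        rw [hstep2]; simp only [hR, hX, hY]; module
      have d3 : ‖(1 - 2 * l k) • (x k - y k) + h k‖ ≤ r + hb k := by
        refine (norm_add_le _ _).trans (add_le_add ?_ (hhn k))
        rw [norm_smul, Real.norm_eq_abs]
        have : |1 - 2 * l k| ≤ 1 := abs_le.2 ⟨by linarith [k4.2], by linarith [k4.1]⟩
        have := mul_le_mul this hg' (norm_nonneg _) zero_le_one
        linarith
      have d4 : ⟪u - p, (1 - 2 * l k) • (x k - y k) + h k⟫_ℝ ≤ U * (r + hb k) :=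
        (real_inner_le_norm _ _).trans (mul_le_mul_of_nonneg_left d3 hU0)
      have d5 : U * r ≤ ε' / 8 := by
        have e1 : r * (8 * (U + 1)) ≤ ε' := by
          rw [← le_div_iff₀ (by positivity)]; exact min_le_right _ _
        nlinarith
      have d6 : ⟪u - p, X (k + 1)⟫_ℝ ≤ 3 * (ε' / 8) := by
        rw [d2, inner_add_right]; linarith
      have d7 : max ⟪u - p, X (k + 1)⟫_ℝ 0 ≤ 3 * (ε' / 8) := max_le d6 (by positivity)
      linarith
  rw [tendsto_iff_norm_sub_tendsto_zero]
  have := hs.sqrt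
  simpa [Real.sqrt_sq] using this

end

/-- Theorem 4.4 (StrongConvergence): if `zer A ≠ ∅`, `∑ (1 - ξ_k²) = ∞`, and one of the four
listed parameter conditions holds, then `x_k → P_{zer A} u` strongly. -/
theorem stmt19 {H : Type*} [NormedAddCommGroup H] [InnerProductSpace ℝ H] [CompleteSpace H]
    (A : H → Set H)
    (hmono : ∀ x y xu yv : H, xu ∈ A x → yv ∈ A y → 0 ≤ ⟪x - y, xu - yv⟫_ℝ)
    (hmax : ∀ x xu : H, (∀ y yv : H, yv ∈ A y → 0 ≤ ⟪x - y, xu - yv⟫_ℝ) → xu ∈ A x)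
    (J : ℝ → H → H)
    (hJ : ∀ c : ℝ, 0 < c → ∀ x : H, (1 / c) • (x - J c x) ∈ A (J c x))
    (u : H) (e : ℕ → H) (c α β γ δ : ℕ → ℝ) (hc : ∀ k, 0 < c k)
    (x : ℕ → H)
    (hrec : ∀ k, x (k + 1) = α k • u + β k • x k + γ k • J (c k) (x k) + δ k • e k)
    (ξ : ℕ → ℝ) (hξ : ∀ k, ξ k = |β k + γ k / 2| + |γ k / 2|)
    (hzer : ∃ p : H, (0 : H) ∈ A p)
    (hξdiv : Tendsto (fun n => ∑ k ∈ Finset.range n, (1 - ξ k ^ 2)) atTop atTop)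
    (hcase :
      -- (1)
      ((∀ k, |α k| + ξ k ≤ 1 ∧ 0 ≤ β k + γ k ∧ ξ k ^ 2 - β k - γ k ≤ 0) ∧
        Summable (fun k => |1 - α k - β k - γ k|) ∧
        Summable (fun k => ‖δ k • e k‖) ∧
        Tendsto α atTop (nhds 0) ∧ Tendsto β atTop (nhds 0) ∧
        Tendsto γ atTop (nhds 1) ∧ Tendsto c atTop atTop) ∨
      -- (2)
      ((∀ k, |α k| + ξ k ≤ 1 ∧ 0 ≤ β k + γ k ∧ ξ k ^ 2 - β k - γ k ≤ 0) ∧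
        Summable (fun k => |1 - α k - β k - γ k|) ∧
        Summable (fun k => ‖δ k • e k‖) ∧
        Tendsto α atTop (nhds 0) ∧
        (∃ r < (1 : ℝ), ∀ᶠ k in atTop, |β k| ≤ r) ∧
        (∃ a > (0 : ℝ), ∀ᶠ k in atTop, a ≤ 1 - β k - γ k / 2) ∧
        (∃ b < (1 : ℝ), ∀ᶠ k in atTop, 1 - β k - γ k / 2 ≤ b) ∧
        Tendsto (fun k => 1 - c k / c (k + 1)) atTop (nhds 0) ∧
        ((∃ ε > (0 : ℝ), ∀ k, ε ≤ c k) ∨ Tendsto c atTop atTop)) ∨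
      -- (3)
      ((∀ k, |α k| + ξ k ≤ 1 ∧ 0 ≤ β k + γ k ∧ ξ k ^ 2 - β k - γ k ≤ 0 ∧ |γ k| ≤ 1) ∧
        Summable (fun k => |(α (k + 1) + γ (k + 1)) - (α k + γ k)|) ∧
        Summable (fun k => |1 - α k - β k - γ k|) ∧
        Summable (fun k => |β k|) ∧
        Tendsto (fun n => ∑ k ∈ Finset.range n, (1 - |γ k|)) atTop atTop ∧
        Summable (fun k => ‖δ k • e k‖) ∧
        (Summable (fun k => |α (k + 1) - α k|) ∨
          ((∀ k, |γ k| ≠ 1) ∧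
            Tendsto (fun k => |α (k + 1) - α k| / (1 - |γ (k + 1)|)) atTop (nhds 0))) ∧
        Tendsto α atTop (nhds 0) ∧ Tendsto (fun k => α k + γ k) atTop (nhds 1) ∧
        (∃ ε > (0 : ℝ), ∀ k, ε ≤ c k) ∧
        Summable (fun k => |c (k + 1) - c k|)) ∨
      -- (4)
      ((∀ k, 0 < α k ∧ α k ≤ 1 ∧ α k + ξ k ≤ 1) ∧
        Tendsto α atTop (nhds 0) ∧ Tendsto β atTop (nhds 0) ∧
        Tendsto γ atTop (nhds 1) ∧
        Tendsto (fun k => (α k)⁻¹ • (δ k • e k)) atTop (nhds (0 : H)) ∧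
        Tendsto (fun k => (1 - α k - β k - γ k) / α k) atTop (nhds 0) ∧
        Tendsto c atTop atTop)) :
    ∃ p : H, (0 : H) ∈ A p ∧ (∀ z : H, (0 : H) ∈ A z → ⟪u - p, z - p⟫_ℝ ≤ 0) ∧
      Tendsto x atTop (nhds p) := by
  obtain ⟨p, hpA, hpv, hp⟩ := aux_proj A hmono hmax J hJ u hzer
  refine ⟨p, hpA, hpv, ?_⟩
  have hξ0 : ∀ k, 0 ≤ ξ k := fun k => by rw [hξ]; positivity
  -- the common part of the first three cases
  have main : (∀ k, |α k| + ξ k ≤ 1 ∧ 0 ≤ β k + γ k ∧ ξ k ^ 2 - β k - γ k ≤ 0) →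
      Summable (fun k => |1 - α k - β k - γ k|) → Summable (fun k => ‖δ k • e k‖) →
      Tendsto α atTop (nhds 0) →
      (∃ κ > (0 : ℝ), ∀ᶠ k in atTop, κ ≤ (1 - β k - γ k / 2) * (1 - (1 - β k - γ k / 2))) →
      (∃ c0 > (0 : ℝ), ∀ᶠ k in atTop, c0 ≤ c k) → Tendsto x atTop (nhds p) := by
    rintro h1 hηs hes hα ⟨κ, hκ, hlam⟩ ⟨c0, hc0, hcc⟩
    have hηt : Tendsto (fun k => 1 - α k - β k - γ k) atTop (nhds 0) :=
      (tendsto_zero_iff_abs_tendsto_zero _).2 hηs.tendsto_atTop_zero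
    refine aux_core A hmono J hJ u p e c α β γ δ hc x hrec ξ hξ hpA hp hξdiv
      (fun k => |1 - α k - β k - γ k| * (1 + ‖p‖) + ‖δ k • e k‖) (fun _ => 0)
      (fun k => by positivity) ((hηs.mul_right _).add hes) (fun _ => le_rfl) tendsto_const_nhds
      (fun k => (h1 k).1) (fun k => ?_) (fun k => ?_) (fun k => ?_) hα hηt κ hκ hlam c0 hc0 hcc
    · have a1 := (h1 k).2.2
      have a2 := neg_abs_le (1 - α k - β k - γ k)
      have a3 : 0 ≤ |1 - α k - β k - γ k| * ‖p‖ := by positivity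
      have a4 := norm_nonneg (δ k • e k)
      show α k ≤ 1 - ξ k ^ 2 + (|1 - α k - β k - γ k| * (1 + ‖p‖) + ‖δ k • e k‖)
      linarith
    · have a2 := le_abs_self (1 - α k - β k - γ k)
      have a3 : 0 ≤ |1 - α k - β k - γ k| * ‖p‖ := by positivity
      have a4 := norm_nonneg (δ k • e k)
      have a5 : β k + γ k ≤ ξ k := by
        rw [hξ]
        have := le_abs_self (β k + γ k / 2)
        have := le_abs_self (γ k / 2)
        linarith
      have a6 := (h1 k).1
      have a7 := abs_nonneg (α k)
      show -(|1 - α k - β k - γ k| * (1 + ‖p‖) + ‖δ k • e k‖) ≤ α k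
      linarith
    · have a3 := abs_nonneg (1 - α k - β k - γ k)
      show _ ≤ |α k| * 0 + (|1 - α k - β k - γ k| * (1 + ‖p‖) + ‖δ k • e k‖)
      linarith
  have hlamt : Tendsto β atTop (nhds 0) → Tendsto γ atTop (nhds 1) →
      ∃ κ > (0 : ℝ), ∀ᶠ k in atTop, κ ≤ (1 - β k - γ k / 2) * (1 - (1 - β k - γ k / 2)) := by
    intro hβ hγ
    have h1 : Tendsto (fun k => 1 - β k - γ k / 2) atTop (nhds (1 - 0 - 1 / 2)) :=
      (tendsto_const_nhds.sub hβ).sub (hγ.div_const 2)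
    have h2 := h1.mul (h1.const_sub 1)
    refine ⟨1 / 8, by norm_num, ?_⟩
    exact h2.eventually (le_mem_nhds (by norm_num))
  have hcinf : Tendsto c atTop atTop → ∃ c0 > (0 : ℝ), ∀ᶠ k in atTop, c0 ≤ c k :=
    fun h => ⟨1, one_pos, h.eventually_ge_atTop 1⟩
  rcases hcase with ⟨h1, hηs, hes, hα, hβ, hγ, hct⟩ |
    ⟨h1, hηs, hes, hα, -, ⟨a, ha, hla⟩, ⟨b, hb, hlb⟩, -, hcd⟩ |
    ⟨h1, -, hηs, hβs, -, hes, -, hα, hαγ, ⟨c0, hc0, hcc⟩, -⟩ |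
    ⟨h1, hα, hβ, hγ, he, hη, hct⟩
  · exact main h1 hηs hes hα (hlamt hβ hγ) (hcinf hct)
  · refine main h1 hηs hes hα ⟨a * (1 - b), mul_pos ha (by linarith), ?_⟩ ?_
    · filter_upwards [hla, hlb] with k k1 k2
      exact mul_le_mul k1 (by linarith) (by linarith) (by linarith)
    · rcases hcd with ⟨c0, hc0, hcc⟩ | hct
      · exact ⟨c0, hc0, Eventually.of_forall hcc⟩
      · exact hcinf hct
  · have hβ : Tendsto β atTop (nhds 0) :=
      (tendsto_zero_iff_abs_tendsto_zero _).2 hβs.tendsto_atTop_zero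
    have hγ : Tendsto γ atTop (nhds 1) := by
      have := hαγ.sub hα
      simpa using this
    exact main (fun k => ⟨(h1 k).1, (h1 k).2.1, (h1 k).2.2.1⟩) hηs hes hα (hlamt hβ hγ)
      ⟨c0, hc0, Eventually.of_forall hcc⟩
  · obtain ⟨κ, hκ, hlam⟩ := hlamt hβ hγ
    obtain ⟨c0, hc0, hcc⟩ := hcinf hct
    have hηt : Tendsto (fun k => 1 - α k - β k - γ k) atTop (nhds 0) := by
      have := ((hα.const_sub 1).sub hβ).sub hγ
      simpa using this
    have hot : Tendsto (fun k => ‖(α k)⁻¹ • (δ k • e k)‖ + |(1 - α k - β k - γ k) / α k| * ‖p‖)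
        atTop (nhds 0) := by
      have := he.norm.add (hη.abs.mul_const ‖p‖)
      simpa using this
    refine aux_core A hmono J hJ u p e c α β γ δ hc x hrec ξ hξ hpA hp hξdiv
      (fun _ => 0) (fun k => ‖(α k)⁻¹ • (δ k • e k)‖ + |(1 - α k - β k - γ k) / α k| * ‖p‖)
      (fun _ => le_rfl) summable_zero (fun k => by positivity) hot
      (fun k => ?_) (fun k => ?_) (fun k => ?_) (fun k => ?_) hα hηt κ hκ hlam c0 hc0 hcc
    · rw [abs_of_pos (h1 k).1]; exact (h1 k).2.2
    · have := (h1 k).2.2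
      have := (h1 k).1
      have := hξ0 k
      show α k ≤ 1 - ξ k ^ 2 + 0
      nlinarith
    · show -(0 : ℝ) ≤ α k
      have := (h1 k).1
      linarith
    · have hpos := (h1 k).1
      apply le_of_eq
      show _ = |α k| * (‖(α k)⁻¹ • (δ k • e k)‖ + |(1 - α k - β k - γ k) / α k| * ‖p‖) + 0
      rw [norm_smul (α k)⁻¹, norm_inv, Real.norm_eq_abs, abs_div]
      have := abs_pos.2 hpos.ne'
      field_simp
      ring
end
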